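/- arXiv:2105.07835 — 8 statements merged into one kernel-verified Lean document; each statement's English description precedes it below -/
import Mathlib

section
/- Let d ∈ ℕ, α > 0 and 0 < b₁ ≤ b₂. There exists a constant A = A(d, α, b₁) > 0 with the following property: if (λ_n)_{n≥0} are positive reals with b₁·max(n,1)^{2/d} ≤ λ_n ≤ b₂·max(n,1)^{2/d} for all n ≥ 0, and for B > 0 one sets H(α,B) = { f ∈ ℓ²(ℕ,ℝ) : Σ_{n≥0} λ_n^α f_n² ≤ B² }, then for every B > 0 and every ε with 0 < ε < A·B there exists a finite set F ⊆ ℓ²(ℕ,ℝ) with card(F) ≤ exp( (A·B/ε)^{d/α} ) such that every f ∈ H(α,B) satisfies ‖f − g‖_{ℓ²} ≤ ε for some g ∈ F. -/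
theorem exists_int_abs_le_abs_sub_le (x : ℝ) : ∃ m : ℤ, |(m : ℝ)| ≤ |x| ∧ |x - m| ≤ 1 := by
  rcases le_total 0 x with hx | hx
  · refine ⟨⌊x⌋, ?_, ?_⟩
    · rw [abs_of_nonneg hx, abs_of_nonneg (by exact_mod_cast Int.floor_nonneg.2 hx)]
      exact Int.floor_le x
    · rw [abs_le]
      constructor <;> linarith [Int.floor_le x, Int.lt_floor_add_one x]
  · refine ⟨⌈x⌉, ?_, ?_⟩
    · rw [abs_of_nonpos hx, abs_of_nonpos (by exact_mod_cast Int.ceil_le.2 (by simpa using hx))]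
      linarith [Int.le_ceil x]
    · rw [abs_le]
      constructor <;> linarith [Int.le_ceil x, Int.ceil_lt_add_one x]

theorem sum_range_exp_neg_mul_le {a : ℝ} (ha : 0 < a) (ha1 : a ≤ 1) (M : ℕ) :
    ∑ k ∈ Finset.range M, Real.exp (-(a * k)) ≤ 2 / a := by
  have hr : Real.exp (-a) ≤ 1 - a / 2 := by
    have h1 := Real.add_one_le_exp a
    have h2 : Real.exp (-a) ≤ (1 + a)⁻¹ := by
      rw [Real.exp_neg]; exact inv_anti₀ (by linarith) (by linarith)
    refine h2.trans ?_
    rw [inv_le_iff_one_le_mul₀ (by linarith)]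
    nlinarith
  have hr1 : Real.exp (-a) < 1 := by linarith
  have e : ∀ k : ℕ, Real.exp (-(a * k)) = Real.exp (-a) ^ k := fun k => by
    rw [← Real.exp_nat_mul]; congr 1; ring
  simp_rw [e]
  calc _ ≤ ∑' k : ℕ, Real.exp (-a) ^ k :=
        (summable_geometric_of_lt_one (Real.exp_pos _).le hr1).sum_le_tsum _
          fun _ _ => by positivity
    _ = (1 - Real.exp (-a))⁻¹ := tsum_geometric_of_lt_one (Real.exp_pos _).le hr1
    _ ≤ (a / 2)⁻¹ := inv_anti₀ (by linarith) (by linarith)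
    _ = 2 / a := by rw [inv_div]

theorem sum_Icc_exp_neg_mul_abs_le {a : ℝ} (ha : 0 < a) (ha1 : a ≤ 1) (M : ℕ) :
    ∑ m ∈ Finset.Icc (-(M : ℤ)) M, Real.exp (-(a * |(m : ℝ)|)) ≤ 4 / a := by
  have hsub : Finset.Icc (-(M : ℤ)) M ⊆
      (Finset.range (M + 1)).image (fun k : ℕ => (k : ℤ)) ∪
        (Finset.range (M + 1)).image (fun k : ℕ => -(k : ℤ)) := by
    intro m hm
    rw [Finset.mem_Icc] at hm
    simp only [Finset.mem_union, Finset.mem_image, Finset.mem_range]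
    rcases le_total 0 m with h | h
    · exact Or.inl ⟨m.toNat, by omega, by omega⟩
    · exact Or.inr ⟨(-m).toNat, by omega, by omega⟩
  have h := sum_range_exp_neg_mul_le ha ha1 (M + 1)
  calc _ ≤ _ := Finset.sum_le_sum_of_subset_of_nonneg hsub fun _ _ _ => (Real.exp_pos _).le
    _ ≤ ∑ m ∈ (Finset.range (M + 1)).image (fun k : ℕ => (k : ℤ)), Real.exp (-(a * |(m : ℝ)|)) +
        ∑ m ∈ (Finset.range (M + 1)).image (fun k : ℕ => -(k : ℤ)),
          Real.exp (-(a * |(m : ℝ)|)) := by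
      rw [← Finset.sum_union_inter]
      exact le_add_of_nonneg_right (Finset.sum_nonneg fun _ _ => (Real.exp_pos _).le)
    _ ≤ 2 / a + 2 / a := by
      rw [Finset.sum_image (by intro x _ y _ h; simpa using h),
        Finset.sum_image (by intro x _ y _ h; simpa using h)]
      simpa using add_le_add h h
    _ = 4 / a := by ring

/-- The integer points of a truncated ellipsoid, counted through an exponential moment. -/
theorem card_lattice_ellipsoid_le {N : ℕ} (a : Fin N → ℝ) (ha : ∀ i, 0 < a i)
    (ha1 : ∀ i, a i ≤ 1) (M : ℕ) :
    (((Fintype.piFinset fun _ : Fin N => Finset.Icc (-(M : ℤ)) M).filter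
      fun m => ∑ i, (a i * (m i : ℝ)) ^ 2 ≤ (N : ℝ)).card : ℝ) ≤ Real.exp N * ∏ i, (4 / a i) := by
  calc _ = ∑ _m ∈ (Fintype.piFinset fun _ : Fin N => Finset.Icc (-(M : ℤ)) M).filter
        (fun m => ∑ i, (a i * (m i : ℝ)) ^ 2 ≤ (N : ℝ)), (1 : ℝ) := by simp
    _ ≤ ∑ m ∈ (Fintype.piFinset fun _ : Fin N => Finset.Icc (-(M : ℤ)) M).filter
        (fun m => ∑ i, (a i * (m i : ℝ)) ^ 2 ≤ (N : ℝ)),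
          Real.exp N * ∏ i, Real.exp (-(a i * |(m i : ℝ)|)) := by
      refine Finset.sum_le_sum fun m hm => ?_
      have hm := (Finset.mem_filter.1 hm).2
      rw [← Real.exp_sum, ← Real.exp_add]
      refine Real.one_le_exp ?_
      have : ∑ i, a i * |(m i : ℝ)| ≤ ∑ i, ((a i * m i) ^ 2 / 2 + 1 / 2) := by
        refine Finset.sum_le_sum fun i _ => ?_
        have : (a i * m i) ^ 2 = (a i * |(m i : ℝ)|) ^ 2 := by
          rw [mul_pow, mul_pow, sq_abs]
        nlinarith [sq_nonneg (a i * |(m i : ℝ)| - 1)]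
      rw [Finset.sum_add_distrib, ← Finset.sum_div] at this
      simp at this
      rw [Finset.sum_neg_distrib]
      linarith
    _ ≤ ∑ m ∈ Fintype.piFinset fun _ : Fin N => Finset.Icc (-(M : ℤ)) M,
          Real.exp N * ∏ i, Real.exp (-(a i * |(m i : ℝ)|)) :=
      Finset.sum_le_sum_of_subset_of_nonneg (Finset.filter_subset _ _)
        fun _ _ _ => by positivity
    _ = Real.exp N * ∏ i, ∑ m ∈ Finset.Icc (-(M : ℤ)) M, Real.exp (-(a i * |(m : ℝ)|)) := by
      rw [← Finset.mul_sum, Finset.prod_univ_sum]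
    _ ≤ _ := by
      gcongr with i
      exact sum_Icc_exp_neg_mul_abs_le (ha i) (ha1 i) M

theorem pow_le_exp_mul_prod_max_one (N : ℕ) :
    (N : ℝ) ^ N ≤ Real.exp (2 * N) * ∏ i : Fin N, max ((i : ℕ) : ℝ) 1 := by
  have hfac : (∏ i : Fin N, max ((i : ℕ) : ℝ) 1) * max (N : ℝ) 1 = (N.factorial : ℝ) := by
    rw [Fin.prod_univ_eq_prod_range (fun i => max (i : ℝ) 1) N, ← Finset.prod_range_succ,
      Finset.prod_range_succ', ← Finset.prod_range_add_one_eq_factorial]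
    push_cast
    simp
  have h := Real.pow_div_factorial_le_exp (N : ℝ) (Nat.cast_nonneg _) N
  rw [div_le_iff₀ (by positivity), ← hfac] at h
  have h2 : max (N : ℝ) 1 ≤ Real.exp N :=
    max_le (by linarith [Real.add_one_le_exp (N : ℝ)]) (Real.one_le_exp (Nat.cast_nonneg _))
  have hP : 0 ≤ ∏ i : Fin N, max ((i : ℕ) : ℝ) 1 := Finset.prod_nonneg fun _ _ => by positivity
  calc _ ≤ _ := h
    _ ≤ Real.exp N * ((∏ i : Fin N, max ((i : ℕ) : ℝ) 1) * Real.exp N) := by gcongr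
    _ = _ := by rw [two_mul, Real.exp_add]; ring

theorem exp_mul_prod_four_div_le {s y : ℝ} {N : ℕ} (hs : 0 < s) (hy : 0 < y)
    (hyN : y ≤ (N : ℝ) ^ s) :
    Real.exp N * ∏ i : Fin N, (4 / (max ((i : ℕ) : ℝ) 1 ^ s / y)) ≤
      Real.exp ((3 + 2 * s) * N) := by
  have hP : 0 < ∏ i : Fin N, max ((i : ℕ) : ℝ) 1 := Finset.prod_pos fun _ _ => by positivity
  have h4 : (4 : ℝ) ≤ Real.exp 2 := by
    have h := Real.quadratic_le_exp_of_nonneg (x := 2) (by norm_num)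
    linarith
  have hprod : ∏ i : Fin N, (4 / (max ((i : ℕ) : ℝ) 1 ^ s / y)) =
      4 ^ N * y ^ N / (∏ i : Fin N, max ((i : ℕ) : ℝ) 1) ^ s := by
    rw [← Real.finsetProd_rpow _ _ fun _ _ => by positivity]
    simp_rw [div_div_eq_mul_div]
    rw [Finset.prod_div_distrib]
    simp [mul_pow]
  have hyp : y ^ N ≤ Real.exp (2 * s * N) * (∏ i : Fin N, max ((i : ℕ) : ℝ) 1) ^ s :=
    calc y ^ N ≤ ((N : ℝ) ^ s) ^ N := by gcongr
      _ = ((N : ℝ) ^ N) ^ s := Real.rpow_pow_comm (Nat.cast_nonneg _) _ _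
      _ ≤ (Real.exp (2 * N) * ∏ i : Fin N, max ((i : ℕ) : ℝ) 1) ^ s :=
        Real.rpow_le_rpow (by positivity) (pow_le_exp_mul_prod_max_one N) hs.le
      _ = _ := by
        rw [Real.mul_rpow (Real.exp_pos _).le hP.le, ← Real.exp_mul]
        ring_nf
  calc _ = Real.exp N * (4 ^ N * (y ^ N / (∏ i : Fin N, max ((i : ℕ) : ℝ) 1) ^ s)) := by
        rw [hprod, mul_div_assoc]
    _ ≤ Real.exp N * (Real.exp 2 ^ N * Real.exp (2 * s * N)) := by
        gcongr
        rw [div_le_iff₀ (by positivity)]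
        exact hyp
    _ = _ := by
        rw [← Real.exp_nat_mul, ← Real.exp_add, ← Real.exp_add]
        ring_nf

theorem exists_lp_extend_zero {N : ℕ} (v : Fin N → ℝ) :
    ∃ g : lp (fun _ : ℕ => ℝ) 2, ∀ n, g n = if h : n < N then v ⟨n, h⟩ else 0 := by
  refine ⟨∑ i : Fin N, lp.single 2 (i : ℕ) (v i), fun n => ?_⟩
  rw [lp.coeFn_sum, Finset.sum_apply]
  split_ifs with h
  · rw [Finset.sum_eq_single ⟨n, h⟩]
    · simp
    · intro b _ hb
      exact lp.single_apply_ne _ _ _ fun e => hb (Fin.ext e.symm)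
    · simp
  · refine Finset.sum_eq_zero fun i _ => lp.single_apply_ne _ _ _ fun e => h (e ▸ i.2)

theorem lp_two_norm_le {f : lp (fun _ : ℕ => ℝ) 2} {C : ℝ} (hC : 0 ≤ C)
    (h : ∀ S : Finset ℕ, ∑ n ∈ S, f n ^ 2 ≤ C ^ 2) : ‖f‖ ≤ C := by
  refine lp.norm_le_of_forall_sum_le (by norm_num) hC fun S => ?_
  simpa using h S

/-- Metric entropy of the ellipsoid with semi-axes `R / max n 1 ^ s` in `ℓ²`. -/
theorem exists_finset_cover_ellipsoid {s R ε : ℝ} (hs : 0 < s) (hR : 0 < R) (hε : 0 < ε) :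
    ∃ F : Finset (lp (fun _ : ℕ => ℝ) 2),
      (F.card : ℝ) ≤ Real.exp ((6 + 4 * s) * (2 * R / ε) ^ s⁻¹) ∧
      ∀ f : lp (fun _ : ℕ => ℝ) 2,
        (∀ S : Finset ℕ, ∑ n ∈ S, (max (n : ℝ) 1 ^ s * f n) ^ 2 ≤ R ^ 2) →
        ∃ g ∈ F, ‖f - g‖ ≤ ε := by
  have hω : ∀ n : ℕ, 1 ≤ max (n : ℝ) 1 ^ s := fun n => Real.one_le_rpow (le_max_right _ _) hs.le
  rcases le_total R ε with hRε | hRε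
  · refine ⟨{0}, by simpa using by positivity, fun f hf => ⟨0, by simp, ?_⟩⟩
    rw [sub_zero]
    refine (lp_two_norm_le hR.le fun S => (Finset.sum_le_sum fun n _ => ?_).trans (hf S)).trans hRε
    rw [mul_pow]
    exact le_mul_of_one_le_left (sq_nonneg _) (one_le_pow₀ (hω n))
  set y := 2 * R / ε with hy
  have hy1 : 1 ≤ y := by rw [hy, le_div_iff₀ hε]; linarith
  have hy0 : 0 < y := by linarith
  set N := ⌈y ^ s⁻¹⌉₊
  have hyr : 1 ≤ y ^ s⁻¹ := Real.one_le_rpow hy1 (by positivity)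
  have hNle : y ^ s⁻¹ ≤ N := Nat.le_ceil _
  have hNlt : (N : ℝ) ≤ 2 * y ^ s⁻¹ := by
    have := Nat.ceil_lt_add_one (zero_le_one.trans hyr)
    linarith
  have hN0 : (0 : ℝ) < N := by linarith
  have hrpow : (y ^ s⁻¹) ^ s = y := Real.rpow_inv_rpow hy0.le hs.ne'
  have hyN : y ≤ (N : ℝ) ^ s := by
    rw [← hrpow]
    exact Real.rpow_le_rpow (by positivity) hNle hs.le
  set a : Fin N → ℝ := fun i => max ((i : ℕ) : ℝ) 1 ^ s / y with ha
  have ha0 : ∀ i, 0 < a i := fun i => by positivity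
  have ha1 : ∀ i, a i ≤ 1 := fun i => by
    rw [ha, div_le_one hy0]
    exact (Real.rpow_le_rpow (by positivity) (max_le (Nat.lt_ceil.1 i.2).le hyr)
      hs.le).trans_eq hrpow
  set δ := ε / (2 * √N) with hδ
  have hδ0 : 0 < δ := by positivity
  have hδsq : N * δ ^ 2 = ε ^ 2 / 4 := by
    rw [hδ, div_pow, mul_pow, Real.sq_sqrt hN0.le]
    field_simp
    norm_num
  choose G hG using fun v : Fin N → ℝ => exists_lp_extend_zero v
  set M := ⌈R / δ⌉₊
  classical
  refine ⟨(((Fintype.piFinset fun _ : Fin N => Finset.Icc (-(M : ℤ)) M).filter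
      fun m => ∑ i, (a i * (m i : ℝ)) ^ 2 ≤ (N : ℝ)).image fun m => G fun i => δ * m i), ?_, ?_⟩
  · calc _ ≤ _ := Nat.cast_le.2 Finset.card_image_le
      _ ≤ _ := card_lattice_ellipsoid_le a ha0 ha1 M
      _ ≤ _ := exp_mul_prod_four_div_le hs hy0 hyN
      _ ≤ _ := Real.exp_le_exp.2 (by nlinarith)
  intro f hf
  choose m hm1 hm2 using fun n : ℕ => exists_int_abs_le_abs_sub_le (f n / δ)
  have hmf : ∀ n, (m n : ℝ) ^ 2 ≤ f n ^ 2 / δ ^ 2 := fun n => by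
    rw [← div_pow]
    exact sq_le_sq.2 (hm1 n)
  have hfm : ∀ n, (f n - δ * m n) ^ 2 ≤ δ ^ 2 := fun n => by
    have h : f n - δ * m n = δ * (f n / δ - m n) := by field_simp
    rw [h, mul_pow]
    exact mul_le_of_le_one_right (sq_nonneg _) ((sq_le_one_iff_abs_le_one _).2 (hm2 n))
  have hfR : ∀ n, |f n| ≤ R := fun n => by
    have h := hf {n}
    rw [Finset.sum_singleton] at h
    refine abs_le_of_sq_le_sq (le_trans ?_ h) hR.le
    rw [mul_pow]
    exact le_mul_of_one_le_left (sq_nonneg _) (one_le_pow₀ (hω n))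
  refine ⟨_, Finset.mem_image_of_mem _ (Finset.mem_filter.2
    ⟨Fintype.mem_piFinset (f := fun i : Fin N => m i) |>.2 fun i => ?_, ?_⟩), ?_⟩
  · have h : |(m i : ℝ)| ≤ M := by
      refine (hm1 i).trans (le_trans ?_ (Nat.le_ceil _))
      rw [abs_div, abs_of_pos hδ0]
      gcongr
      exact hfR i
    rw [Finset.mem_Icc, ← abs_le]
    exact_mod_cast h
  · calc ∑ i : Fin N, (a i * (m i : ℝ)) ^ 2
        ≤ ∑ i : Fin N, (max ((i : ℕ) : ℝ) 1 ^ s * f i) ^ 2 / (y * δ) ^ 2 := by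
          refine Finset.sum_le_sum fun i _ => ?_
          calc (a i * (m i : ℝ)) ^ 2 = a i ^ 2 * (m i : ℝ) ^ 2 := mul_pow _ _ _
            _ ≤ a i ^ 2 * (f i ^ 2 / δ ^ 2) := by gcongr; exact hmf i
            _ = _ := by simp only [ha]; field_simp
      _ = (∑ n ∈ Finset.range N, (max (n : ℝ) 1 ^ s * f n) ^ 2) / (y * δ) ^ 2 := by
          rw [← Finset.sum_div,
            Fin.sum_univ_eq_sum_range (fun n => (max (n : ℝ) 1 ^ s * f n) ^ 2) N]
      _ ≤ R ^ 2 / (y * δ) ^ 2 := by gcongr; exact hf _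
      _ = N := by
          have : δ ^ 2 = ε ^ 2 / 4 / N := by rw [← hδsq]; field_simp
          rw [mul_pow, this, hy]
          field_simp
          norm_num
  · refine lp_two_norm_le hε.le fun S => ?_
    have hpt : ∀ n, (f - G fun i : Fin N => δ * m i : lp (fun _ : ℕ => ℝ) 2) n ^ 2 ≤
        (if n < N then δ ^ 2 else 0) + (max (n : ℝ) 1 ^ s * f n) ^ 2 / y ^ 2 := fun n => by
      rw [lp.coeFn_sub, Pi.sub_apply, hG]
      split_ifs with h
      · exact (hfm n).trans (le_add_of_nonneg_right (by positivity))
      · have hle : y ≤ max (n : ℝ) 1 ^ s := hyN.trans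
          (Real.rpow_le_rpow hN0.le (le_max_of_le_left (by exact_mod_cast not_lt.1 h)) hs.le)
        rw [sub_zero, zero_add, le_div_iff₀ (by positivity), mul_pow, mul_comm]
        gcongr
    calc _ ≤ ∑ n ∈ S, ((if n < N then δ ^ 2 else 0) +
            (max (n : ℝ) 1 ^ s * f n) ^ 2 / y ^ 2) := Finset.sum_le_sum fun n _ => hpt n
      _ ≤ N * δ ^ 2 + R ^ 2 / y ^ 2 := by
        rw [Finset.sum_add_distrib, ← Finset.sum_div, ← Finset.sum_filter, Finset.sum_const,
          nsmul_eq_mul]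
        gcongr
        · refine (Finset.card_le_card (t := Finset.range N) fun n hn => ?_).trans_eq
            (Finset.card_range N)
          exact Finset.mem_range.2 (Finset.mem_filter.1 hn).2
        · exact hf S
      _ = ε ^ 2 / 2 := by
        rw [hδsq, hy]
        field_simp
        norm_num
      _ ≤ ε ^ 2 := by linarith [sq_nonneg ε]

/-- Metric entropy of the Sobolev-type ball
`H(α,B) = {f ∈ ℓ²(ℕ,ℝ) : Σ_n λ_n^α f_n² ≤ B²}` in the `ℓ²`-distance:
for eigenvalues `b₁·max(n,1)^{2/d} ≤ λ_n ≤ b₂·max(n,1)^{2/d}` there is a constant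
`A = A(d,α,b₁) > 0` such that for all `B > 0` and `0 < ε < A·B` the ball can be covered
by at most `exp((A·B/ε)^{d/α})` `ℓ²`-balls of radius `ε`. -/
theorem stmt0 (d : ℕ) (hd : 0 < d) (α : ℝ) (hα : 0 < α) (b₁ : ℝ) (hb₁ : 0 < b₁) :
    ∃ A : ℝ, 0 < A ∧
      ∀ b₂ : ℝ, b₁ ≤ b₂ →
      ∀ lam : ℕ → ℝ,
        (∀ n : ℕ, 0 < lam n) →
        (∀ n : ℕ, b₁ * (max (n : ℝ) 1) ^ ((2 : ℝ) / d) ≤ lam n ∧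
            lam n ≤ b₂ * (max (n : ℝ) 1) ^ ((2 : ℝ) / d)) →
        ∀ B : ℝ, 0 < B → ∀ ε : ℝ, 0 < ε → ε < A * B →
          ∃ F : Finset (lp (fun _ : ℕ => ℝ) 2),
            (F.card : ℝ) ≤ Real.exp ((A * B / ε) ^ ((d : ℝ) / α)) ∧
            ∀ f : lp (fun _ : ℕ => ℝ) 2,
              (∑' n : ℕ, ENNReal.ofReal (lam n ^ α * f n ^ 2)) ≤ ENNReal.ofReal (B ^ 2) →
              ∃ g ∈ F, ‖f - g‖ ≤ ε := by
  set s : ℝ := α / d with hs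
  have hd' : (0 : ℝ) < d := by exact_mod_cast hd
  have hs0 : 0 < s := by positivity
  refine ⟨(6 + 4 * s) ^ s * 2 / b₁ ^ (α / 2), by positivity, ?_⟩
  intro b₂ _ lam hlam hbd B hB ε hε _
  obtain ⟨F, hF, hcov⟩ := exists_finset_cover_ellipsoid (R := B / b₁ ^ (α / 2)) hs0
    (by positivity) hε
  refine ⟨F, hF.trans_eq ?_, fun f hf => hcov f fun S => ?_⟩
  · have h : (6 + 4 * s) ^ s * 2 / b₁ ^ (α / 2) * B / ε =
        (6 + 4 * s) ^ s * (2 * (B / b₁ ^ (α / 2)) / ε) := by ring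
    rw [h, Real.mul_rpow (by positivity) (by positivity), ← inv_div α, ← hs,
      Real.rpow_rpow_inv (by positivity) hs0.ne']
  · have hsum : ∑ n ∈ S, lam n ^ α * f n ^ 2 ≤ B ^ 2 := by
      have h := (ENNReal.sum_le_tsum S).trans hf
      rw [← ENNReal.ofReal_sum_of_nonneg fun n _ =>
        mul_nonneg (Real.rpow_nonneg (hlam n).le _) (sq_nonneg _)] at h
      exact (ENNReal.ofReal_le_ofReal_iff (by positivity)).1 h
    have hb : (b₁ ^ (α / 2)) ^ 2 = b₁ ^ α := by
      rw [← Real.rpow_mul_natCast hb₁.le]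
      congr 1
      push_cast
      ring
    rw [div_pow, le_div_iff₀ (by positivity), hb, Finset.sum_mul]
    refine (Finset.sum_le_sum fun n _ => ?_).trans hsum
    have hmax : (0 : ℝ) < max (n : ℝ) 1 := by positivity
    have hw : (max (n : ℝ) 1 ^ s) ^ 2 = (max (n : ℝ) 1 ^ ((2 : ℝ) / d)) ^ α := by
      rw [← Real.rpow_mul_natCast hmax.le, ← Real.rpow_mul hmax.le, hs]
      congr 1
      push_cast
      ring
    calc (max (n : ℝ) 1 ^ s * f n) ^ 2 * b₁ ^ α
        = (b₁ * max (n : ℝ) 1 ^ ((2 : ℝ) / d)) ^ α * f n ^ 2 := by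
          rw [mul_pow, hw, Real.mul_rpow hb₁.le (by positivity)]
          ring
      _ ≤ lam n ^ α * f n ^ 2 := by
          gcongr
          exact (hbd n).1
end

section
/- Let H be a separable complex Hilbert space with orthonormal basis (e_n)_{n∈ℕ}, and let (λ_n)_{n∈ℕ} be real numbers with inf_n λ_n > 0. For s ∈ ℝ and x ∈ H set ‖x‖_s² = Σ_n λ_n^s |⟨x, e_n⟩|² ∈ [0, ∞]. Let N be a bounded linear operator on H with ⟨N x, x⟩ ≥ 0 for all x ∈ H (so N is self-adjoint and nonnegative), and suppose there are constants n̂, n̄ > 0 such that ‖N x‖₁ ≤ n̂·‖x‖_H and ‖x‖_H ≤ n̄·‖N x‖₁ for all x ∈ H, and that the range of N equals { y ∈ H : ‖y‖₁ < ∞ }. Let √N denote the nonnegative square root of N given by continuous functional calculus. Then: (i) √N is injective, its range equals { y ∈ H : ‖y‖_{1/2} < ∞ }, and ‖x‖_H ≤ n̄^{1/2}·‖√N x‖_{1/2} for all x ∈ H; (ii) Σ_n λ_n^{−1/2} |⟨x, e_n⟩|² ≤ n̄·⟨N x, x⟩ for all x ∈ H. -/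
open scoped InnerProductSpace ENNReal ComplexOrder

noncomputable section

/-- The (possibly infinite) squared norm `‖x‖_s² = Σ_n λ_n^s |⟨x, e_n⟩|²` of the scale
generated by the orthonormal basis `(e_n)` and the eigenvalues `(λ_n)`. -/
def scaleNormSq {H : Type*} [NormedAddCommGroup H] [InnerProductSpace ℂ H]
    (e : ℕ → H) (lam : ℕ → ℝ) (s : ℝ) (x : H) : ℝ≥0∞ :=
  ∑' n : ℕ, ENNReal.ofReal (lam n ^ s * ‖⟪e n, x⟫_ℂ‖ ^ 2)

/-- The diagonal operator with bounded real entries `d` in a Hilbert basis. -/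
lemma HilbertBasis.exists_diagonal {H : Type*} [NormedAddCommGroup H] [InnerProductSpace ℂ H]
    (b : HilbertBasis ℕ ℂ H) (d : ℕ → ℝ) {C : ℝ} (hd : ∀ n, |d n| ≤ C) :
    ∃ D : H →L[ℂ] H, ∀ n x, ⟪b n, D x⟫_ℂ = d n * ⟪b n, x⟫_ℂ := by
  have hC : 0 ≤ C := (abs_nonneg _).trans (hd 0)
  let T : ∀ _ : ℕ, ℂ →L[ℂ] ℂ := fun n => (d n : ℂ) • ContinuousLinearMap.id ℂ ℂ
  have hT : ∀ n, ‖T n‖ ≤ C := fun n =>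
    ContinuousLinearMap.opNorm_le_bound _ hC fun z => by
      simpa [T] using mul_le_mul_of_nonneg_right (hd n) (norm_nonneg z)
  refine ⟨(b.repr.symm : _ →L[ℂ] H) ∘L lp.mapCLM 2 T (K := C) hC hT ∘L (b.repr : H →L[ℂ] _), ?_⟩
  intro n x
  rw [← b.repr_apply_apply, ← b.repr_apply_apply]
  simp [T]

lemma HilbertBasis.hasSum_norm_inner_sq {H : Type*} [NormedAddCommGroup H]
    [InnerProductSpace ℂ H] (b : HilbertBasis ℕ ℂ H) (x : H) :
    HasSum (fun n => ‖⟪b n, x⟫_ℂ‖ ^ 2) (‖x‖ ^ 2) := by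
  have h := Complex.hasSum_re (b.hasSum_inner_mul_inner x x)
  convert h using 1
  · funext n
    rw [← inner_conj_symm x (b n), ← Complex.normSq_eq_conj_mul_self, Complex.normSq_eq_norm_sq,
      Complex.ofReal_re]
  · rw [inner_self_eq_norm_sq_to_K]
    norm_cast

lemma HilbertBasis.ext_inner {H : Type*} [NormedAddCommGroup H] [InnerProductSpace ℂ H]
    (b : HilbertBasis ℕ ℂ H) {x y : H} (h : ∀ n, ⟪b n, x⟫_ℂ = ⟪b n, y⟫_ℂ) : x = y := by
  apply b.repr.injective
  ext n
  simpa only [b.repr_apply_apply] using h n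

/-- If the coefficients of `u` are those of `x` weighted by `λ_n^{s/2}`, then
`‖x‖_s = ‖u‖`. -/
lemma scaleNormSq_eq_norm_sq {H : Type*} [NormedAddCommGroup H] [InnerProductSpace ℂ H]
    (b : HilbertBasis ℕ ℂ H) {lam : ℕ → ℝ} (hlam : ∀ n, 0 < lam n) {s : ℝ} {x u : H}
    (h : ∀ n, ⟪b n, u⟫_ℂ = (lam n ^ (s / 2) : ℝ) * ⟪b n, x⟫_ℂ) :
    scaleNormSq (fun n => b n) lam s x = ENNReal.ofReal (‖u‖ ^ 2) := by
  have hu := b.hasSum_norm_inner_sq u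
  rw [← hu.tsum_eq, ENNReal.ofReal_tsum_of_nonneg (fun n => by positivity) hu.summable]
  refine tsum_congr fun n => ?_
  rw [h, norm_mul, mul_pow, Complex.norm_real, Real.norm_eq_abs, sq_abs,
    ← Real.rpow_natCast (lam n ^ (s / 2)), ← Real.rpow_mul (hlam n).le]
  norm_num

/-- A vector of finite `s`-norm has weighted coefficients in `ℓ²`. -/
lemma exists_weighted_of_scaleNormSq_lt_top {H : Type*} [NormedAddCommGroup H]
    [InnerProductSpace ℂ H] (b : HilbertBasis ℕ ℂ H) {lam : ℕ → ℝ} (hlam : ∀ n, 0 < lam n)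
    {s : ℝ} {x : H} (hx : scaleNormSq (fun n => b n) lam s x < ⊤) :
    ∃ u : H, ∀ n, ⟪b n, u⟫_ℂ = (lam n ^ (s / 2) : ℝ) * ⟪b n, x⟫_ℂ := by
  have hmem : Memℓp (fun n => ((lam n ^ (s / 2) : ℝ) : ℂ) * ⟪b n, x⟫_ℂ) 2 := by
    rw [memℓp_gen_iff (by norm_num)]
    refine (ENNReal.summable_toReal hx.ne).congr fun n => ?_
    have := hlam n
    rw [ENNReal.toReal_ofReal (by positivity), norm_mul, Complex.norm_real, Real.norm_eq_abs,
      ENNReal.toReal_ofNat, Real.rpow_two, mul_pow, sq_abs,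
      ← Real.rpow_natCast (lam n ^ (s / 2)), ← Real.rpow_mul this.le]
    norm_num
  refine ⟨b.repr.symm ⟨_, hmem⟩, fun n => ?_⟩
  rw [← b.repr_apply_apply]
  simp

lemma HilbertBasis.isPositive_of_diagonal {H : Type*} [NormedAddCommGroup H]
    [InnerProductSpace ℂ H] (b : HilbertBasis ℕ ℂ H) {d : ℕ → ℝ} (hd : ∀ n, 0 ≤ d n)
    {D : H →L[ℂ] H} (hD : ∀ n x, ⟪b n, D x⟫_ℂ = d n * ⟪b n, x⟫_ℂ) : D.IsPositive := by
  rw [ContinuousLinearMap.isPositive_iff_complex]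
  intro x
  have h := b.hasSum_inner_mul_inner (D x) x
  have hterm : ∀ n, ⟪D x, b n⟫_ℂ * ⟪b n, x⟫_ℂ = ((d n * ‖⟪b n, x⟫_ℂ‖ ^ 2 : ℝ) : ℂ) := by
    intro n
    rw [← inner_conj_symm (D x) (b n), hD, map_mul, Complex.conj_ofReal, mul_assoc,
      ← Complex.normSq_eq_conj_mul_self, Complex.normSq_eq_norm_sq]
    push_cast
    ring
  simp_rw [hterm] at h
  have hre := Complex.hasSum_re h
  have him := Complex.hasSum_im h
  simp only [Complex.ofReal_re, Complex.ofReal_im] at hre him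
  refine ⟨?_, hre.nonneg fun n => mul_nonneg (hd n) (by positivity)⟩
  apply Complex.ext
  · simp
  · simpa using (hasSum_zero.unique him)

/-- **Heinz–Löwner inequality** for the square root, in terms of quadratic forms. -/
lemma ContinuousLinearMap.IsPositive.re_inner_le_of_norm_le {H : Type*} [NormedAddCommGroup H]
    [InnerProductSpace ℂ H] [CompleteSpace H] {A B : H →L[ℂ] H} (hA : A.IsPositive)
    (hB : B.IsPositive) (h : ∀ x, ‖A x‖ ≤ ‖B x‖) (x : H) :
    (⟪A x, x⟫_ℂ).re ≤ (⟪B x, x⟫_ℂ).re := by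
  have hsq : A * A ≤ B * B := by
    rw [ContinuousLinearMap.le_def, ContinuousLinearMap.isPositive_iff_complex]
    intro x
    have key : ⟪(B * B - A * A) x, x⟫_ℂ = ((‖B x‖ ^ 2 - ‖A x‖ ^ 2 : ℝ) : ℂ) := by
      simp only [sub_apply, mul_apply_eq_comp, inner_sub_left]
      rw [hB.inner_left_eq_inner_right, hA.inner_left_eq_inner_right,
        inner_self_eq_norm_sq_to_K, inner_self_eq_norm_sq_to_K]
      norm_cast
    rw [key]
    rw [RCLike.re_eq_complex_re, Complex.ofReal_re]
    exact ⟨rfl, sub_nonneg.2 (pow_le_pow_left₀ (norm_nonneg _) (h x) 2)⟩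
  have hle : A ≤ B := by
    have := CFC.sqrt_le_sqrt _ _ hsq
    rwa [CFC.sqrt_mul_self A ((ContinuousLinearMap.nonneg_iff_isPositive A).2 hA),
      CFC.sqrt_mul_self B ((ContinuousLinearMap.nonneg_iff_isPositive B).2 hB)] at this
  have := ((ContinuousLinearMap.le_def _ _).1 hle).re_inner_nonneg_left x
  simpa [inner_sub_left] using this

/-- **Douglas factorization** for self-adjoint operators: a bound `‖A x‖ ≤ c ‖B x‖` puts the
range of `A` inside the range of `B`, with control of the preimages. -/
lemma IsSelfAdjoint.exists_apply_eq_of_norm_le {H : Type*} [NormedAddCommGroup H]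
    [InnerProductSpace ℂ H] [CompleteSpace H] {A B : H →L[ℂ] H} (hA : IsSelfAdjoint A)
    (hB : IsSelfAdjoint B) (hinj : Function.Injective B) {c : ℝ} (hc : 0 ≤ c)
    (h : ∀ x, ‖A x‖ ≤ c * ‖B x‖) (x : H) : ∃ z, B z = A x ∧ ‖z‖ ≤ c * ‖x‖ := by
  have hdense : DenseRange B := by
    have hbot : B.rangeᗮ = ⊥ := by
      rw [B.orthogonal_range, hB.adjoint_eq]
      exact LinearMap.ker_eq_bot.2 hinj
    exact Submodule.dense_iff_topologicalClosure_eq_top.2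
      (Submodule.topologicalClosure_eq_top_iff.2 hbot)
  let C : H →L[ℂ] H := LinearMap.extendOfNorm A.toLinearMap B.toLinearMap
  have hCB : ∀ y, C (B y) = A y := LinearMap.extendOfNorm_eq hdense ⟨c, h⟩
  have hC : ‖C‖ ≤ c := LinearMap.opNorm_extendOfNorm_le hdense hc h
  refine ⟨C.adjoint x, ?_, ?_⟩
  · refine ext_inner_right ℂ fun y => ?_
    rw [← ContinuousLinearMap.adjoint_inner_right, hB.adjoint_eq,
      ContinuousLinearMap.adjoint_inner_left, hCB, ← ContinuousLinearMap.adjoint_inner_right,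
      hA.adjoint_eq]
  · refine (C.adjoint.le_opNorm x).trans (mul_le_mul_of_nonneg_right ?_ (norm_nonneg x))
    rwa [LinearIsometryEquiv.norm_map]

/-- A converse to `IsSelfAdjoint.exists_apply_eq_of_norm_le`. -/
lemma ContinuousLinearMap.IsPositive.norm_le_of_exists_apply_eq {H : Type*}
    [NormedAddCommGroup H] [InnerProductSpace ℂ H] {A B : H →L[ℂ] H} (hA : A.IsPositive)
    (hB : B.IsPositive) {c : ℝ} (h : ∀ x, ∃ z, B z = A x ∧ ‖z‖ ≤ c * ‖x‖) (x : H) :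
    ‖A x‖ ≤ c * ‖B x‖ := by
  obtain ⟨z, hz, hzn⟩ := h (A x)
  have hle : ‖A x‖ * ‖A x‖ ≤ c * ‖B x‖ * ‖A x‖ := by
    calc
      ‖A x‖ * ‖A x‖ = ‖⟪A x, A x⟫_ℂ‖ := by
        rw [inner_self_eq_norm_sq_to_K, norm_pow, RCLike.norm_ofReal, abs_norm, sq]
      _ = ‖⟪B x, z⟫_ℂ‖ := by
        rw [hA.inner_left_eq_inner_right, ← hz, hB.inner_left_eq_inner_right]
      _ ≤ ‖B x‖ * ‖z‖ := norm_inner_le_norm _ _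
      _ ≤ ‖B x‖ * (c * ‖A x‖) := by gcongr
      _ = c * ‖B x‖ * ‖A x‖ := by ring
  rcases (norm_nonneg (A x)).eq_or_lt with h0 | h0
  · have hAx : A x = 0 := norm_eq_zero.1 h0.symm
    obtain ⟨w, -, hw⟩ := h (B x)
    rw [hAx, norm_zero]
    exact (norm_nonneg w).trans hw
  · exact le_of_mul_le_mul_right hle h0

/-- The operator `L^{-s/2}`, an isometry of `H` onto the space `H_L^s`. -/
lemma exists_isPositive_scaleNormSq_eq {H : Type*} [NormedAddCommGroup H]
    [InnerProductSpace ℂ H] (b : HilbertBasis ℕ ℂ H) {lam : ℕ → ℝ} {c : ℝ} (hc : 0 < c)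
    (hlam : ∀ n, c ≤ lam n) {s : ℝ} (hs : 0 ≤ s) :
    ∃ D : H →L[ℂ] H, D.IsPositive ∧
      (∀ n x, ⟪b n, D x⟫_ℂ = (lam n ^ (-(s / 2)) : ℝ) * ⟪b n, x⟫_ℂ) ∧
      (∀ x, scaleNormSq (fun n => b n) lam s (D x) = ENNReal.ofReal (‖x‖ ^ 2)) ∧
      ∀ y, scaleNormSq (fun n => b n) lam s y < ⊤ → ∃ x, D x = y := by
  have hpos : ∀ n, 0 < lam n := fun n => hc.trans_le (hlam n)
  have hbound : ∀ n, |lam n ^ (-(s / 2))| ≤ c ^ (-(s / 2)) := fun n => by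
    rw [abs_of_pos (Real.rpow_pos_of_pos (hpos n) _)]
    exact Real.rpow_le_rpow_of_nonpos hc (hlam n) (by linarith)
  have hcancel : ∀ n, ((lam n ^ (s / 2) : ℝ) : ℂ) * (lam n ^ (-(s / 2)) : ℝ) = 1 := fun n => by
    rw [← Complex.ofReal_mul, ← Real.rpow_add (hpos n), add_neg_cancel, Real.rpow_zero,
      Complex.ofReal_one]
  obtain ⟨D, hD⟩ := b.exists_diagonal (fun n => lam n ^ (-(s / 2))) hbound
  refine ⟨D, b.isPositive_of_diagonal (fun n => Real.rpow_nonneg (hpos n).le _) hD, hD,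
    fun x => scaleNormSq_eq_norm_sq b hpos fun n => ?_, fun y hy => ?_⟩
  · rw [hD, ← mul_assoc, hcancel, one_mul]
  · obtain ⟨x, hx⟩ := exists_weighted_of_scaleNormSq_lt_top b hpos hy
    refine ⟨x, b.ext_inner fun n => ?_⟩
    rw [hD, hx, ← mul_assoc, mul_comm ((lam n ^ (-(s / 2)) : ℝ) : ℂ), hcancel, one_mul]

/-- Heinz–Löwner lemma (Lemma 4.11): if the nonnegative bounded operator `N` is an
isomorphism of `H` onto the space `H¹` of the scale, then its nonnegative square root
`√N` is an isomorphism onto `H^{1/2}`, with the quantitative stability estimates (i)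
`‖x‖ ≤ n̄^{1/2}·‖√N x‖_{1/2}` and (ii) `‖x‖²_{(H^{1/2})*} ≤ n̄·⟨Nx,x⟩`. -/
theorem stmt2 {H : Type*} [NormedAddCommGroup H] [InnerProductSpace ℂ H] [CompleteSpace H]
    (b : HilbertBasis ℕ ℂ H)
    (lam : ℕ → ℝ) (hlam : ∃ c : ℝ, 0 < c ∧ ∀ n, c ≤ lam n)
    (N : H →L[ℂ] H) (hNpos : ∀ x : H, 0 ≤ ⟪N x, x⟫_ℂ)
    (nhat nbar : ℝ) (hnhat : 0 < nhat) (hnbar : 0 < nbar)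
    (hfwd : ∀ x : H,
      scaleNormSq (fun n => b n) lam 1 (N x) ≤ ENNReal.ofReal (nhat ^ 2 * ‖x‖ ^ 2))
    (hstab : ∀ x : H,
      ENNReal.ofReal (‖x‖ ^ 2) ≤
        ENNReal.ofReal (nbar ^ 2) * scaleNormSq (fun n => b n) lam 1 (N x))
    (hrange : Set.range (fun x => N x) = {y : H | scaleNormSq (fun n => b n) lam 1 y < ⊤})
    -- `S` is the nonnegative square root `√N` of `N`:
    (S : H →L[ℂ] H) (hSpos : ∀ x : H, 0 ≤ ⟪S x, x⟫_ℂ) (hSsq : ∀ x : H, S (S x) = N x) :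
    (Function.Injective (fun x => S x) ∧
      Set.range (fun x => S x) = {y : H | scaleNormSq (fun n => b n) lam (1 / 2) y < ⊤} ∧
      ∀ x : H,
        ENNReal.ofReal (‖x‖ ^ 2) ≤
          ENNReal.ofReal nbar * scaleNormSq (fun n => b n) lam (1 / 2) (S x)) ∧
    ∀ x : H,
      scaleNormSq (fun n => b n) lam (-(1 / 2)) x ≤
        ENNReal.ofReal (nbar * (⟪N x, x⟫_ℂ).re) := by
  obtain ⟨c, hc, hcl⟩ := hlam
  have hpos : ∀ n, 0 < lam n := fun n => hc.trans_le (hcl n)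
  have isPositive_of {T : H →L[ℂ] H} (h : ∀ x, 0 ≤ ⟪T x, x⟫_ℂ) : T.IsPositive :=
    (ContinuousLinearMap.isPositive_iff_complex T).2 fun x => by
      obtain ⟨hre, him⟩ := Complex.nonneg_iff.1 (h x)
      exact ⟨Complex.ext rfl him, hre⟩
  have hN := isPositive_of hNpos
  have hS := isPositive_of hSpos
  obtain ⟨K, hK, hKd, hKn, hKsurj⟩ := exists_isPositive_scaleNormSq_eq b hc hcl zero_le_one
  obtain ⟨Q, hQ, hQd, hQn, hQsurj⟩ :=
    exists_isPositive_scaleNormSq_eq b hc hcl (s := 1 / 2) (by norm_num)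
  have hQQ : ∀ x, Q (Q x) = K x := fun x => b.ext_inner fun n => by
    rw [hQd, hQd, hKd, ← mul_assoc, ← Complex.ofReal_mul, ← Real.rpow_add (hpos n)]
    norm_num
  have re_inner_sq {T R : H →L[ℂ] H} (hR : R.IsPositive) (h : ∀ x, R (R x) = T x) (x : H) :
      (⟪T x, x⟫_ℂ).re = ‖R x‖ ^ 2 := by
    rw [← h, hR.inner_left_eq_inner_right]
    exact inner_self_eq_norm_sq (𝕜 := ℂ) (R x)
  have hNK : ∀ x, ‖N x‖ ≤ nhat * ‖K x‖ := hN.norm_le_of_exists_apply_eq hK fun x => by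
    obtain ⟨z, hz⟩ := hKsurj (N x) ((hfwd x).trans_lt ENNReal.ofReal_lt_top)
    refine ⟨z, hz, ?_⟩
    have := hfwd x
    rw [← hz, hKn, ENNReal.ofReal_le_ofReal_iff (by positivity), ← mul_pow] at this
    exact (sq_le_sq₀ (norm_nonneg _) (by positivity)).1 this
  have hKN : ∀ x, ‖K x‖ ≤ nbar * ‖N x‖ := hK.norm_le_of_exists_apply_eq hN fun x => by
    obtain ⟨z, hz⟩ : K x ∈ Set.range (fun x => N x) := by
      rw [hrange, Set.mem_ofPred_eq, hKn]
      exact ENNReal.ofReal_lt_top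
    refine ⟨z, hz, ?_⟩
    have := hstab z
    rw [show N z = K x from hz, hKn, ← ENNReal.ofReal_mul (by positivity),
      ENNReal.ofReal_le_ofReal_iff (by positivity), ← mul_pow] at this
    exact (sq_le_sq₀ (norm_nonneg _) (by positivity)).1 this
  have re_inner_le {A B : H →L[ℂ] H} (hA : A.IsPositive) (hB : B.IsPositive) {r : ℝ} (hr : 0 < r)
      (h : ∀ x, ‖A x‖ ≤ r * ‖B x‖) (x : H) : (⟪A x, x⟫_ℂ).re ≤ r * (⟪B x, x⟫_ℂ).re := by
    have := hA.re_inner_le_of_norm_le (B := (r : ℂ) • B)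
      (hB.smul_of_nonneg (Complex.zero_le_real.2 hr.le))
      (fun y => by simpa [norm_smul, abs_of_pos hr] using h y) x
    simpa [inner_smul_left] using this
  have norm_le_of_sq {r s t : ℝ} (hr : 0 < r) (ht : 0 ≤ t) (h : s ^ 2 ≤ r * t ^ 2) :
      s ≤ √r * t := by
    refine abs_le_of_sq_le_sq' ?_ (by positivity) |>.2
    rwa [mul_pow, Real.sq_sqrt hr.le]
  have hQS_sq : ∀ x, ‖Q x‖ ^ 2 ≤ nbar * ‖S x‖ ^ 2 := fun x => by
    rw [← re_inner_sq hQ hQQ, ← re_inner_sq hS hSsq]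
    exact re_inner_le hK hN hnbar hKN x
  have hSQ_sq : ∀ x, ‖S x‖ ^ 2 ≤ nhat * ‖Q x‖ ^ 2 := fun x => by
    rw [← re_inner_sq hQ hQQ, ← re_inner_sq hS hSsq]
    exact re_inner_le hN hK hnhat hNK x
  have hQinj : Function.Injective Q := (injective_iff_map_eq_zero Q).2 fun x hx => by
    have := hQn x
    rw [hx] at this
    simpa [scaleNormSq] using this.symm
  have hSinj : Function.Injective S := (injective_iff_map_eq_zero S).2 fun x hx => by
    have h0 := hQS_sq x
    rw [hx, norm_zero, zero_pow two_ne_zero, mul_zero] at h0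
    have : Q x = 0 := by simpa using le_antisymm h0 (by positivity)
    exact hQinj (by rw [this, map_zero])
  have hSQ := hS.isSelfAdjoint.exists_apply_eq_of_norm_le hQ.isSelfAdjoint hQinj
    (Real.sqrt_nonneg nhat) fun x => norm_le_of_sq hnhat (norm_nonneg _) (hSQ_sq x)
  have hQS := hQ.isSelfAdjoint.exists_apply_eq_of_norm_le hS.isSelfAdjoint hSinj
    (Real.sqrt_nonneg nbar) fun x => norm_le_of_sq hnbar (norm_nonneg _) (hQS_sq x)
  refine ⟨⟨hSinj, Set.ext fun y => ⟨?_, fun hy => ?_⟩, fun x => ?_⟩, fun x => ?_⟩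
  · rintro ⟨x, rfl⟩
    obtain ⟨z, hz, -⟩ := hSQ x
    simp only [Set.mem_ofPred_eq]
    rw [← hz, hQn]
    exact ENNReal.ofReal_lt_top
  · obtain ⟨z, rfl⟩ := hQsurj y hy
    obtain ⟨x, hx, -⟩ := hQS z
    exact ⟨x, hx⟩
  · obtain ⟨z, hz, -⟩ := hSQ x
    obtain ⟨w, hw, hwn⟩ := hQS z
    obtain rfl : w = x := hSinj (hw.trans hz)
    rw [← hz, hQn, ← ENNReal.ofReal_mul hnbar.le]
    refine ENNReal.ofReal_le_ofReal ?_
    simpa [mul_pow, Real.sq_sqrt hnbar.le] using pow_le_pow_left₀ (norm_nonneg w) hwn 2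
  · rw [scaleNormSq_eq_norm_sq b hpos (u := Q x) fun n => by rw [hQd, neg_div]]
    refine ENNReal.ofReal_le_ofReal ?_
    rw [re_inner_sq hS hSsq]
    exact hQS_sq x
end
end

section
/- Let (𝒳, 𝒜, λ) be a probability space, d_V ∈ ℕ and U ≥ 1. There exist constants c₀, c₁ > 0 depending only on U and d_V such that for all measurable g, g' : 𝒳 → ℝ^{d_V} with sup_x |g(x)| ≤ U and sup_x |g'(x)| ≤ U, the Hellinger distance between the corresponding Gaussian regression densities satisfies (1/c₀)·‖g − g'‖_{L²(λ)} ≤ h(p_g, p_{g'}) ≤ c₁·‖g − g'‖_{L²(λ)}. -/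
open MeasureTheory

/-- The Gaussian regression density
`p_g(y,x) = (2π)^{−d_V/2}·exp(−|y − g(x)|²/2)` on `ℝ^{d_V} × 𝒳`. -/
noncomputable def pdens {𝒳 : Type*} (dV : ℕ) (g : 𝒳 → EuclideanSpace ℝ (Fin dV))
    (w : EuclideanSpace ℝ (Fin dV) × 𝒳) : ℝ :=
  (2 * Real.pi) ^ (-(dV : ℝ) / 2) * Real.exp (-‖w.1 - g w.2‖ ^ 2 / 2)

/-- The Hellinger distance
`h(p,q) = (∫_{ℝ^{d_V}×𝒳} (√p − √q)² dy dλ(x))^{1/2}`. -/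
noncomputable def hellinger {𝒳 : Type*} [MeasurableSpace 𝒳] (dV : ℕ) (μ : Measure 𝒳)
    (p q : EuclideanSpace ℝ (Fin dV) × 𝒳 → ℝ) : ℝ :=
  Real.sqrt (∫ w, (Real.sqrt (p w) - Real.sqrt (q w)) ^ 2
    ∂((volume : Measure (EuclideanSpace ℝ (Fin dV))).prod μ))

section GaussianRegression

variable {𝒳 : Type*} {dV : ℕ}

lemma pdens_nonneg (g : 𝒳 → EuclideanSpace ℝ (Fin dV)) (w : EuclideanSpace ℝ (Fin dV) × 𝒳) :
    0 ≤ pdens dV g w := by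
  unfold pdens; positivity

lemma pdens_section_integral (g : 𝒳 → EuclideanSpace ℝ (Fin dV)) (x : 𝒳) :
    ∫ y, pdens dV g (y, x) = 1 := by
  have h := GaussianFourier.integral_rexp_neg_mul_sq_norm
    (V := EuclideanSpace ℝ (Fin dV)) (b := 1 / 2) (by norm_num)
  simp only [pdens]
  rw [integral_const_mul,
    integral_sub_right_eq_self (fun y : EuclideanSpace ℝ (Fin dV) ↦ Real.exp (-‖y‖ ^ 2 / 2)) (g x)]
  have h_exp : (fun y : EuclideanSpace ℝ (Fin dV) ↦ Real.exp (-‖y‖ ^ 2 / 2))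
      = fun y ↦ Real.exp (-(1 / 2) * ‖y‖ ^ 2) := by
    ext y; ring_nf
  rw [h_exp, h, finrank_euclideanSpace_fin, show Real.pi / (1 / 2) = 2 * Real.pi by ring,
    ← Real.rpow_add (by positivity)]
  ring_nf
  simp

lemma pdens_section_integrable (g : 𝒳 → EuclideanSpace ℝ (Fin dV)) (x : 𝒳) :
    Integrable fun y ↦ pdens dV g (y, x) :=
  .of_integral_ne_zero (by simp [pdens_section_integral])

/-- The geometric mean of two Gaussian densities is a damped Gaussian density centred at the
midpoint. -/
lemma sq_sqrt_pdens_sub_sqrt_pdens (g g' : 𝒳 → EuclideanSpace ℝ (Fin dV))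
    (w : EuclideanSpace ℝ (Fin dV) × 𝒳) :
    (√(pdens dV g w) - √(pdens dV g' w)) ^ 2 =
      pdens dV g w + pdens dV g' w
        - 2 * (Real.exp (-‖g w.2 - g' w.2‖ ^ 2 / 8)
          * pdens dV (fun x ↦ (1 / 2 : ℝ) • (g x + g' x)) w) := by
  have h_mid : √(pdens dV g w) * √(pdens dV g' w) = Real.exp (-‖g w.2 - g' w.2‖ ^ 2 / 8)
      * pdens dV (fun x ↦ (1 / 2 : ℝ) • (g x + g' x)) w := by
    rw [← Real.sqrt_mul (pdens_nonneg g w), Real.sqrt_eq_iff_mul_self_eq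
      (mul_nonneg (pdens_nonneg g w) (pdens_nonneg g' w))
      (mul_nonneg (Real.exp_nonneg _) (pdens_nonneg _ w))]
    simp only [pdens]
    set K := (2 * Real.pi) ^ (-(dV : ℝ) / 2)
    have h_par := parallelogram_law_with_norm ℝ (w.1 - g w.2) (w.1 - g' w.2)
    have h_sum : w.1 - g w.2 + (w.1 - g' w.2)
        = (2 : ℝ) • (w.1 - (1 / 2 : ℝ) • (g w.2 + g' w.2)) := by module
    have h_diff : w.1 - g w.2 - (w.1 - g' w.2) = -(g w.2 - g' w.2) := by abel
    rw [h_sum, h_diff, norm_neg, norm_smul, Real.norm_ofNat] at h_par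
    have h_exp : -‖w.1 - g w.2‖ ^ 2 / 2 + -‖w.1 - g' w.2‖ ^ 2 / 2
        = 2 * (-‖g w.2 - g' w.2‖ ^ 2 / 8
          + -‖w.1 - (1 / 2 : ℝ) • (g w.2 + g' w.2)‖ ^ 2 / 2) := by
      linarith
    rw [mul_mul_mul_comm, ← Real.exp_add, h_exp, two_mul (_ + _), Real.exp_add, Real.exp_add]
    ring
  rw [sub_sq, Real.sq_sqrt (pdens_nonneg g w), Real.sq_sqrt (pdens_nonneg g' w), mul_assoc, h_mid]
  ring

variable [MeasurableSpace 𝒳] {g g' : 𝒳 → EuclideanSpace ℝ (Fin dV)}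

lemma measurable_pdens (hg : Measurable g) : Measurable (pdens dV g) := by
  unfold pdens; fun_prop

lemma integrable_pdens (μ : Measure 𝒳) [IsFiniteMeasure μ] (hg : Measurable g) :
    Integrable (pdens dV g) (volume.prod μ) := by
  rw [integrable_prod_iff' (measurable_pdens hg).aestronglyMeasurable]
  refine ⟨.of_forall (pdens_section_integrable g), ?_⟩
  simp [Real.norm_of_nonneg (pdens_nonneg _ _), pdens_section_integral]

lemma integral_sq_sqrt_pdens_sub_sqrt_pdens (μ : Measure 𝒳) [IsFiniteMeasure μ]
    (hg : Measurable g) (hg' : Measurable g') :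
    ∫ w, (√(pdens dV g w) - √(pdens dV g' w)) ^ 2 ∂(volume.prod μ) =
      ∫ x, 2 * (1 - Real.exp (-‖g x - g' x‖ ^ 2 / 8)) ∂μ := by
  simp only [sq_sqrt_pdens_sub_sqrt_pdens]
  rw [integral_prod_symm]
  · refine integral_congr_ae (.of_forall fun x ↦ ?_)
    have h₁ := pdens_section_integrable g x
    have h₂ := pdens_section_integrable g' x
    have h₃ := pdens_section_integrable (fun x ↦ (1 / 2 : ℝ) • (g x + g' x)) x
    dsimp only
    rw [integral_sub (h₁.fun_add h₂) ((h₃.const_mul _).const_mul _), integral_add h₁ h₂,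
      integral_const_mul, integral_const_mul]
    simp only [pdens_section_integral]
    ring
  · refine ((integrable_pdens μ hg).add (integrable_pdens μ hg')).sub (Integrable.const_mul ?_ _)
    refine (integrable_pdens μ (by fun_prop)).bdd_mul (c := 1)
      (Measurable.aestronglyMeasurable (by fun_prop)) (.of_forall fun w ↦ ?_)
    rw [Real.norm_of_nonneg (Real.exp_nonneg _), Real.exp_le_one_iff]
    linarith [sq_nonneg ‖g w.2 - g' w.2‖]

end GaussianRegression

lemma Real.div_one_add_le_one_sub_exp_neg {t T : ℝ} (ht : 0 ≤ t) (htT : t ≤ T) :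
    t / (1 + T) ≤ 1 - Real.exp (-t) := by
  have h_exp : Real.exp (-t) ≤ 1 / (1 + t) := by
    rw [Real.exp_neg, ← one_div]
    exact one_div_le_one_div_of_le (by linarith) (by linarith [Real.add_one_le_exp t])
  calc t / (1 + T) ≤ t / (1 + t) := by gcongr
    _ = 1 - 1 / (1 + t) := by field_simp; ring
    _ ≤ 1 - Real.exp (-t) := by linarith

/-- Proposition 5.3: for uniformly bounded regression functions, the Hellinger distance
between the Gaussian regression densities is two-sided comparable to the
`L²(λ)`-distance of the regression functions, with constants depending only on
`U` and `d_V`. -/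
theorem stmt3 (dV : ℕ) (hdV : 0 < dV) (U : ℝ) (hU : 1 ≤ U) :
    ∃ c₀ c₁ : ℝ, 0 < c₀ ∧ 0 < c₁ ∧
      ∀ (𝒳 : Type) [MeasurableSpace 𝒳], ∀ (μ : Measure 𝒳), IsProbabilityMeasure μ →
        ∀ g g' : 𝒳 → EuclideanSpace ℝ (Fin dV),
          Measurable g → Measurable g' →
          (∀ x, ‖g x‖ ≤ U) → (∀ x, ‖g' x‖ ≤ U) →
          (1 / c₀) * Real.sqrt (∫ x, ‖g x - g' x‖ ^ 2 ∂μ) ≤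
              hellinger dV μ (pdens dV g) (pdens dV g') ∧
            hellinger dV μ (pdens dV g) (pdens dV g') ≤
              c₁ * Real.sqrt (∫ x, ‖g x - g' x‖ ^ 2 ∂μ) := by
  refine ⟨√(4 + 2 * U ^ 2), 1 / 2, by positivity, by norm_num, ?_⟩
  intro 𝒳 _ μ _ g g' hg hg' hgU hgU'
  have h_dist (x : 𝒳) : ‖g x - g' x‖ ^ 2 ≤ 4 * U ^ 2 := by
    have h : ‖g x - g' x‖ ≤ 2 * U := by linarith [norm_sub_le (g x) (g' x), hgU x, hgU' x]
    calc ‖g x - g' x‖ ^ 2 ≤ (2 * U) ^ 2 := by gcongr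
      _ = 4 * U ^ 2 := by ring
  have h_int : Integrable (fun x ↦ ‖g x - g' x‖ ^ 2) μ :=
    .of_bound (Measurable.aestronglyMeasurable (by fun_prop)) (4 * U ^ 2)
      (.of_forall fun x ↦ by simpa using h_dist x)
  have h_int_exp : Integrable (fun x ↦ 2 * (1 - Real.exp (-‖g x - g' x‖ ^ 2 / 8))) μ := by
    refine ((integrable_const 1).sub (.of_bound (C := 1)
      (Measurable.aestronglyMeasurable (by fun_prop)) (.of_forall fun x ↦ ?_))).const_mul 2
    rw [Real.norm_of_nonneg (Real.exp_nonneg _), Real.exp_le_one_iff]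
    linarith [sq_nonneg ‖g x - g' x‖]
  rw [hellinger, integral_sq_sqrt_pdens_sub_sqrt_pdens μ hg hg']
  constructor
  · rw [one_div_mul_eq_div, ← Real.sqrt_div' _ (by positivity), ← integral_div]
    refine Real.sqrt_le_sqrt (integral_mono (h_int.div_const _) h_int_exp fun x ↦ ?_)
    have h := Real.div_one_add_le_one_sub_exp_neg (t := ‖g x - g' x‖ ^ 2 / 8) (T := U ^ 2 / 2)
      (by positivity) (by linarith [h_dist x])
    calc ‖g x - g' x‖ ^ 2 / (4 + 2 * U ^ 2)
        = 2 * (‖g x - g' x‖ ^ 2 / 8 / (1 + U ^ 2 / 2)) := by field_simp; ring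
      _ ≤ 2 * (1 - Real.exp (-‖g x - g' x‖ ^ 2 / 8)) := by rw [neg_div]; gcongr
  · rw [show (1 / 2 : ℝ) = √(1 / 4) by symm; rw [Real.sqrt_eq_iff_mul_self_eq] <;> norm_num,
      ← Real.sqrt_mul (by norm_num), ← integral_const_mul]
    refine Real.sqrt_le_sqrt (integral_mono h_int_exp (h_int.const_mul _) fun x ↦ ?_)
    dsimp only
    linarith [Real.add_one_le_exp (-‖g x - g' x‖ ^ 2 / 8)]
end

section
/- Let (𝒳, 𝒜, λ) be a probability space, d_V ∈ ℕ, U ≥ 1, and let g★, g : 𝒳 → ℝ^{d_V} be measurable with sup_x |g★(x)| ≤ U and sup_x |g(x)| ≤ U. Set u := 2(U² + 1) and let δ > 0. If ∫_𝒳 |g(x) − g★(x)|² dλ(x) ≤ δ²/u, then E_{P_{g★}}[ L(Y, X) ] ≤ δ² and E_{P_{g★}}[ L(Y, X)² ] ≤ δ², where L(y,x) := log(p_{g★}/p_g)(y,x) = |y − g(x)|²/2 − |y − g★(x)|²/2. -/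
open MeasureTheory

/-- The law `P_g` on `ℝ^{d_V} × 𝒳` of `(Y, X)` where `X ∼ λ` and `Y = g(X) + ε` with
standard Gaussian noise `ε`; it has density `p_g` with respect to `dy ⊗ dλ`. -/
noncomputable def obsLaw {𝒳 : Type*} [MeasurableSpace 𝒳] (dV : ℕ) (μ : Measure 𝒳)
    (g : 𝒳 → EuclideanSpace ℝ (Fin dV)) : Measure (EuclideanSpace ℝ (Fin dV) × 𝒳) :=
  ((volume : Measure (EuclideanSpace ℝ (Fin dV))).prod μ).withDensity
    fun w => ENNReal.ofReal (pdens dV g w)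

/-- The standard Gaussian measure on `ℝ^d` has the usual density with respect to Lebesgue measure. -/
lemma withDensity_eq_stdGaussian (d : ℕ) :
    (volume : Measure (EuclideanSpace ℝ (Fin d))).withDensity
      (fun v => ENNReal.ofReal ((2 * Real.pi) ^ (-(d : ℝ) / 2) * Real.exp (-‖v‖ ^ 2 / 2))) =
    ProbabilityTheory.stdGaussian (EuclideanSpace ℝ (Fin d)) := by
  have hre : 0 < ((1 / 2 : ℂ)).re := by norm_num
  have hint : Integrable (fun v : EuclideanSpace ℝ (Fin d) =>
      (2 * Real.pi) ^ (-(d : ℝ) / 2) * Real.exp (-‖v‖ ^ 2 / 2)) := by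
    have h := (GaussianFourier.integrable_cexp_neg_mul_sq_norm_add hre 0
      (0 : EuclideanSpace ℝ (Fin d))).norm
    refine (h.congr (ae_of_all _ fun v => ?_)).const_mul _
    simp only [Complex.norm_exp]
    congr 1
    simp [← Complex.ofReal_pow]
    ring
  have := isFiniteMeasure_withDensity_ofReal hint.2
  apply Measure.ext_of_charFun
  ext t
  rw [ProbabilityTheory.charFun_stdGaussian, charFun_apply,
    integral_withDensity_eq_integral_toReal_smul (by fun_prop) (by simp)]
  have hpt : ∀ v : EuclideanSpace ℝ (Fin d),
      (ENNReal.ofReal ((2 * Real.pi) ^ (-(d : ℝ) / 2) * Real.exp (-‖v‖ ^ 2 / 2))).toReal •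
        Complex.exp (inner ℝ v t * Complex.I) =
      (((2 * Real.pi) ^ (-(d : ℝ) / 2) : ℝ) : ℂ) *
        Complex.exp (-(1 / 2) * ‖v‖ ^ 2 + Complex.I * inner ℝ t v) := by
    intro v
    rw [ENNReal.toReal_ofReal (by positivity), Complex.real_smul, Complex.ofReal_mul, mul_assoc,
      Complex.ofReal_exp, ← Complex.exp_add, real_inner_comm]
    congr 2
    push_cast
    ring
  simp_rw [hpt]
  rw [integral_const_mul, GaussianFourier.integral_cexp_neg_mul_sq_norm_add hre, ← mul_assoc]
  have hpi : (Real.pi : ℂ) / (1 / 2) = ((2 * Real.pi : ℝ) : ℂ) := by push_cast; ring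
  have hexp : ((Module.finrank ℝ (EuclideanSpace ℝ (Fin d)) : ℂ) / 2) =
      (((d : ℝ) / 2 : ℝ) : ℂ) := by simp
  rw [hpi, hexp, ← Complex.ofReal_cpow (by positivity), ← Complex.ofReal_mul,
    ← Real.rpow_add (by positivity)]
  have h0 : -(d : ℝ) / 2 + d / 2 = 0 := by ring
  rw [h0, Real.rpow_zero, Complex.ofReal_one, one_mul, Complex.I_sq]
  congr 1
  ring

/-- `P_g` is the law of `(g(X) + ε, X)` with `ε` standard Gaussian independent of `X ∼ μ`. -/
lemma obsLaw_eq_map {𝒳 : Type*} [MeasurableSpace 𝒳] (d : ℕ) (μ : Measure 𝒳) [SFinite μ]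
    {g : 𝒳 → EuclideanSpace ℝ (Fin d)} (hg : Measurable g) :
    obsLaw d μ g =
      ((ProbabilityTheory.stdGaussian (EuclideanSpace ℝ (Fin d))).prod μ).map
        (fun z => (g z.2 + z.1, z.2)) := by
  have hT : Measurable (fun z : EuclideanSpace ℝ (Fin d) × 𝒳 => (g z.2 + z.1, z.2)) := by
    fun_prop
  have hp : Measurable (fun w => ENNReal.ofReal (pdens d g w)) := by
    unfold pdens
    fun_prop
  ext s hs
  rw [Measure.map_apply hT hs, Measure.prod_apply_symm (hT hs), obsLaw, withDensity_apply _ hs,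
    ← lintegral_indicator hs, lintegral_prod_symm' _ (hp.indicator hs)]
  refine lintegral_congr fun x => ?_
  have hsx : MeasurableSet ((fun e : EuclideanSpace ℝ (Fin d) => (e, x)) ⁻¹'
      ((fun z : EuclideanSpace ℝ (Fin d) × 𝒳 => (g z.2 + z.1, z.2)) ⁻¹' s)) :=
    measurable_prodMk_right (hT hs)
  rw [← withDensity_eq_stdGaussian, withDensity_apply _ hsx, ← lintegral_indicator hsx,
    ← lintegral_add_left_eq_self _ (g x)]
  refine lintegral_congr fun e => ?_
  simp only [Set.indicator, pdens, add_sub_cancel_left]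
  rfl

/-- Integration against `P_g`: first over the noise, then over the design. -/
lemma integral_obsLaw {𝒳 : Type*} [MeasurableSpace 𝒳] (d : ℕ) (μ : Measure 𝒳) [SFinite μ]
    {g : 𝒳 → EuclideanSpace ℝ (Fin d)} (hg : Measurable g)
    {F : EuclideanSpace ℝ (Fin d) × 𝒳 → ℝ} (hF : Integrable F (obsLaw d μ g)) :
    ∫ w, F w ∂(obsLaw d μ g) =
      ∫ x, ∫ e, F (g x + e, x) ∂ProbabilityTheory.stdGaussian (EuclideanSpace ℝ (Fin d)) ∂μ := by
  have hT : Measurable (fun z : EuclideanSpace ℝ (Fin d) × 𝒳 => (g z.2 + z.1, z.2)) := by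
    fun_prop
  rw [obsLaw_eq_map d μ hg] at hF ⊢
  rw [integral_map hT.aemeasurable hF.1]
  exact integral_prod_symm _ (hF.comp_measurable hT)

section Moments

variable {E : Type*} [NormedAddCommGroup E] [InnerProductSpace ℝ E] [FiniteDimensional ℝ E]
  [MeasurableSpace E] [BorelSpace E]

lemma integrable_inner_stdGaussian (h : E) :
    Integrable (fun e => inner ℝ h e) (ProbabilityTheory.stdGaussian E) :=
  ProbabilityTheory.IsGaussian.integrable_dual _ (innerSL ℝ h)

lemma integral_inner_stdGaussian (h : E) :
    ∫ e, inner ℝ h e ∂ProbabilityTheory.stdGaussian E = 0 :=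
  ProbabilityTheory.integral_strongDual_stdGaussian (innerSL ℝ h)

lemma integrable_inner_sq_stdGaussian (h : E) :
    Integrable (fun e => inner ℝ h e ^ 2) (ProbabilityTheory.stdGaussian E) :=
  (ProbabilityTheory.IsGaussian.memLp_dual (ProbabilityTheory.stdGaussian E)
    (innerSL ℝ h) 2 (by simp)).integrable_sq

lemma integral_inner_sq_stdGaussian (h : E) :
    ∫ e, inner ℝ h e ^ 2 ∂ProbabilityTheory.stdGaussian E = ‖h‖ ^ 2 := by
  have hv := ProbabilityTheory.variance_dual_stdGaussian (innerSL ℝ h)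
  rw [ProbabilityTheory.variance_eq_sub
    (ProbabilityTheory.IsGaussian.memLp_dual _ _ 2 (by simp)),
    ProbabilityTheory.integral_strongDual_stdGaussian, innerSL_apply_norm] at hv
  simpa using hv

lemma integral_inner_add_const_stdGaussian (h : E) (a : ℝ) :
    ∫ e, (inner ℝ h e + a) ∂ProbabilityTheory.stdGaussian E = a := by
  rw [integral_add (integrable_inner_stdGaussian h) (integrable_const a),
    integral_inner_stdGaussian]
  simp

lemma integral_inner_add_const_sq_stdGaussian (h : E) (a : ℝ) :
    ∫ e, (inner ℝ h e + a) ^ 2 ∂ProbabilityTheory.stdGaussian E = ‖h‖ ^ 2 + a ^ 2 := by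
  have hexp : ∀ e : E, (inner ℝ h e + a) ^ 2 =
      inner ℝ h e ^ 2 + 2 * a * inner ℝ h e + a ^ 2 := fun e => by ring
  have hlin := (integrable_inner_stdGaussian h).const_mul (2 * a)
  simp_rw [hexp]
  rw [integral_add ((integrable_inner_sq_stdGaussian h).fun_add hlin) (integrable_const _),
    integral_add (integrable_inner_sq_stdGaussian h) hlin, integral_inner_sq_stdGaussian, integral_const_mul,
    integral_inner_stdGaussian]
  simp

end Moments

/-- Lemma 5.4: if `∫|g − g★|² dλ ≤ δ²/u` with `u = 2(U²+1)`, then the log-likelihood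
ratio `L = log(p_{g★}/p_g)` satisfies `E_{P_{g★}}[L] ≤ δ²` and `E_{P_{g★}}[L²] ≤ δ²`. -/
theorem stmt4 (dV : ℕ) (hdV : 0 < dV) (U : ℝ) (hU : 1 ≤ U)
    (𝒳 : Type*) [MeasurableSpace 𝒳] (μ : Measure 𝒳) [IsProbabilityMeasure μ]
    (gstar g : 𝒳 → EuclideanSpace ℝ (Fin dV))
    (hgstarm : Measurable gstar) (hgm : Measurable g)
    (hgstarb : ∀ x, ‖gstar x‖ ≤ U) (hgb : ∀ x, ‖g x‖ ≤ U)
    (δ : ℝ) (hδ : 0 < δ)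
    (hL2 : (∫ x, ‖g x - gstar x‖ ^ 2 ∂μ) ≤ δ ^ 2 / (2 * (U ^ 2 + 1))) :
    (∫ w, (‖w.1 - g w.2‖ ^ 2 / 2 - ‖w.1 - gstar w.2‖ ^ 2 / 2)
        ∂(obsLaw dV μ gstar)) ≤ δ ^ 2 ∧
      (∫ w, (‖w.1 - g w.2‖ ^ 2 / 2 - ‖w.1 - gstar w.2‖ ^ 2 / 2) ^ 2
          ∂(obsLaw dV μ gstar)) ≤ δ ^ 2 := by
  have hnn : 0 ≤ ∫ x, ‖g x - gstar x‖ ^ 2 ∂μ := integral_nonneg fun x => by positivity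
  have hbd : ∀ x, ‖g x - gstar x‖ ≤ 2 * U := fun x =>
    (norm_sub_le _ _).trans (by linarith [hgb x, hgstarb x])
  have hint : Integrable (fun x => ‖g x - gstar x‖ ^ 2) μ := by
    refine Integrable.of_bound (by fun_prop) ((2 * U) ^ 2) (ae_of_all _ fun x => ?_)
    rw [Real.norm_of_nonneg (by positivity)]
    exact pow_le_pow_left₀ (norm_nonneg _) (hbd x) 2
  have hmain : (U ^ 2 + 1) * ∫ x, ‖g x - gstar x‖ ^ 2 ∂μ ≤ δ ^ 2 := by
    rw [le_div_iff₀ (by positivity)] at hL2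
    nlinarith [mul_nonneg hnn (by positivity : 0 ≤ U ^ 2 + 1)]
  have hpt : ∀ x (e : EuclideanSpace ℝ (Fin dV)),
      ‖gstar x + e - g x‖ ^ 2 / 2 - ‖gstar x + e - gstar x‖ ^ 2 / 2 =
        inner ℝ (gstar x - g x) e + ‖g x - gstar x‖ ^ 2 / 2 := by
    intro x e
    rw [add_sub_cancel_left, add_sub_right_comm, norm_add_sq_real, norm_sub_rev (g x)]
    ring
  constructor
  · by_cases hL : Integrable (fun w : EuclideanSpace ℝ (Fin dV) × 𝒳 =>
        ‖w.1 - g w.2‖ ^ 2 / 2 - ‖w.1 - gstar w.2‖ ^ 2 / 2) (obsLaw dV μ gstar)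
    · rw [integral_obsLaw dV μ hgstarm hL]
      simp_rw [hpt, integral_inner_add_const_stdGaussian]
      rw [integral_div]
      nlinarith [mul_nonneg hnn (sq_nonneg U)]
    · rw [integral_undef hL]
      positivity
  · by_cases hL : Integrable (fun w : EuclideanSpace ℝ (Fin dV) × 𝒳 =>
        (‖w.1 - g w.2‖ ^ 2 / 2 - ‖w.1 - gstar w.2‖ ^ 2 / 2) ^ 2) (obsLaw dV μ gstar)
    · rw [integral_obsLaw dV μ hgstarm hL]
      simp_rw [hpt, integral_inner_add_const_sq_stdGaussian]
      refine le_trans ?_ hmain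
      rw [← integral_const_mul]
      refine integral_mono_of_nonneg (ae_of_all _ fun x => by positivity)
        (hint.const_mul _) (ae_of_all _ fun x => ?_)
      have hsq : ‖g x - gstar x‖ ^ 2 ≤ (2 * U) ^ 2 :=
        pow_le_pow_left₀ (norm_nonneg _) (hbd x) 2
      dsimp only
      rw [norm_sub_rev (gstar x)]
      nlinarith [mul_le_mul_of_nonneg_left hsq (sq_nonneg ‖g x - gstar x‖)]
    · rw [integral_undef hL]
      positivity
end

section
/- Let A : ℝ² × ℝ × ℝ → ℂ be smooth, 2π-periodic in its second (angle) argument, with all partial derivatives bounded, and let f : ℝ² → ℂ be smooth with compact support contained in the open unit disk 𝔻. Set A₀(x,θ) = A(x,θ,0), A₁(x,θ,t) = ∫_0^1 ∂_t A(x,θ,s·t) ds, Ã₀(x,θ) = ∂_θ( sin θ · A₀(x,θ) ), and Ã₁(x,θ,t) = ∂_θ( sin θ · A₁(x,θ,t) ) − ∂_t( t·cos θ · A₁(x,θ,t) ). Then for every x ∈ 𝔻 and θ ∈ ℝ the principal-value limit Hf(x,θ) = lim_{ε→0⁺} (1/π) ∫_{|t|>ε} f(x + t·(cos θ, sin θ))/t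 dt exists, and for every x ∈ 𝔻: T_A(∂_{x₁} f)(x) = π ∫_0^{2π} Ã₀(x,θ)·Hf(x,θ) dθ + T_{Ã₁} f(x). -/
noncomputable section

open Complex MeasureTheory

/-- The singular integral operator
`T_A f(x) = ∫_0^{2π} ∫_ℝ A(x, θ, t)·f(x + t·(cos θ, sin θ)) dt dθ`,
with the plane `ℝ²` identified with `ℂ` (so that `(cos θ, sin θ) = e^{iθ}`). -/
def TA (A : ℂ → ℝ → ℝ → ℂ) (f : ℂ → ℂ) (x : ℂ) : ℂ :=
  ∫ θ in (0 : ℝ)..(2 * Real.pi),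
    ∫ t : ℝ, A x θ t * f (x + (t : ℂ) * Complex.exp ((θ : ℂ) * Complex.I))

/-- `A₀(x,θ) = A(x,θ,0)`. -/
def Azero (A : ℂ → ℝ → ℝ → ℂ) (x : ℂ) (θ : ℝ) : ℂ := A x θ 0

/-- `A₁(x,θ,t) = ∫_0^1 ∂_t A(x,θ,s·t) ds` from the Taylor expansion `A = A₀ + t·A₁`. -/
def Aone (A : ℂ → ℝ → ℝ → ℂ) (x : ℂ) (θ : ℝ) (t : ℝ) : ℂ :=
  ∫ s in (0 : ℝ)..1, deriv (fun r => A x θ r) (s * t)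

/-- `Ã₀(x,θ) = ∂_θ( sin θ · A₀(x,θ) )`. -/
def Atilde0 (A : ℂ → ℝ → ℝ → ℂ) (x : ℂ) (θ : ℝ) : ℂ :=
  deriv (fun φ => ((Real.sin φ : ℝ) : ℂ) * Azero A x φ) θ

/-- `Ã₁(x,θ,t) = ∂_θ( sin θ · A₁(x,θ,t) ) − ∂_t( t·cos θ · A₁(x,θ,t) )`. -/
def Atilde1 (A : ℂ → ℝ → ℝ → ℂ) (x : ℂ) (θ : ℝ) (t : ℝ) : ℂ :=
  deriv (fun φ => ((Real.sin φ : ℝ) : ℂ) * Aone A x φ t) θ -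
    deriv (fun r => ((r * Real.cos θ : ℝ) : ℂ) * Aone A x θ r) t

/-- The Hadamard quotient in the second variable: `u θ t = u θ 0 + t * hadamardQuotient u θ t`. -/
def hadamardQuotient (u : ℝ → ℝ → ℂ) (θ t : ℝ) : ℂ :=
  ∫ s in (0 : ℝ)..1, deriv (fun r => u θ r) (s * t)

theorem contDiff_uncurry_deriv_snd {u : ℝ → ℝ → ℂ}
    (hu : ContDiff ℝ (⊤ : ℕ∞) (Function.uncurry u)) :
    ContDiff ℝ (⊤ : ℕ∞) (Function.uncurry fun θ t => deriv (u θ) t) := by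
  have h : ContDiff ℝ (⊤ : ℕ∞) (Function.uncurry fun (p : ℝ × ℝ) (r : ℝ) => u p.1 r) :=
    hu.comp (contDiff_fst.fst.prodMk contDiff_snd)
  exact (h.fderiv (m := (⊤ : ℕ∞)) contDiff_snd le_rfl).clm_apply contDiff_const

theorem contDiff_uncurry_deriv_fst {u : ℝ → ℝ → ℂ}
    (hu : ContDiff ℝ (⊤ : ℕ∞) (Function.uncurry u)) :
    ContDiff ℝ (⊤ : ℕ∞) (Function.uncurry fun θ t => deriv (fun φ => u φ t) θ) := by
  have h : ContDiff ℝ (⊤ : ℕ∞) (Function.uncurry fun (p : ℝ × ℝ) (r : ℝ) => u r p.2) :=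
    hu.comp (contDiff_snd.prodMk contDiff_fst.snd)
  exact (h.fderiv (m := (⊤ : ℕ∞)) contDiff_fst le_rfl).clm_apply contDiff_const

theorem differentiable_uncurry_left {u : ℝ → ℝ → ℂ}
    (hu : ContDiff ℝ (⊤ : ℕ∞) (Function.uncurry u)) (t : ℝ) :
    Differentiable ℝ fun θ => u θ t :=
  (hu.comp (contDiff_id.prodMk contDiff_const)).differentiable (by simp)

theorem differentiable_uncurry_right {u : ℝ → ℝ → ℂ}
    (hu : ContDiff ℝ (⊤ : ℕ∞) (Function.uncurry u)) (θ : ℝ) :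
    Differentiable ℝ (u θ) :=
  (hu.comp (contDiff_const.prodMk contDiff_id)).differentiable (by simp)

theorem hasDerivAt_intervalIntegral_param {w w' : ℝ → ℝ → ℂ}
    (hw : Continuous (Function.uncurry w)) (hw' : Continuous (Function.uncurry w'))
    (h : ∀ θ s, HasDerivAt (fun φ => w φ s) (w' θ s) θ) (θ a b : ℝ) :
    HasDerivAt (fun φ => ∫ s in a..b, w φ s) (∫ s in a..b, w' θ s) θ := by
  obtain ⟨C, hC⟩ := ((isCompact_Icc (a := θ - 1) (b := θ + 1)).prod
    (isCompact_uIcc (a := a) (b := b))).exists_bound_of_continuousOn hw'.continuousOn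
  refine (intervalIntegral.hasDerivAt_integral_of_dominated_loc_of_deriv_le
    (bound := fun _ => C) (Icc_mem_nhds (sub_one_lt θ) (lt_add_one θ))
    (Filter.Eventually.of_forall fun φ => ?_) ?_ ?_ ?_ (by simp) ?_).2
  · exact (hw.comp (Continuous.prodMk_right φ)).aestronglyMeasurable
  · exact (hw.comp (Continuous.prodMk_right θ)).intervalIntegrable _ _
  · exact (hw'.comp (Continuous.prodMk_right θ)).aestronglyMeasurable
  · exact Filter.Eventually.of_forall fun s hs φ hφ =>
      hC (φ, s) ⟨hφ, Set.uIoc_subset_uIcc hs⟩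
  · exact Filter.Eventually.of_forall fun s _ φ _ => h φ s

theorem mul_hadamardQuotient {u : ℝ → ℝ → ℂ}
    (hu : ContDiff ℝ (⊤ : ℕ∞) (Function.uncurry u)) (θ t : ℝ) :
    (t : ℂ) * hadamardQuotient u θ t = u θ t - u θ 0 := by
  have h := intervalIntegral.smul_integral_comp_mul_right (a := 0) (b := 1)
    (fun r => deriv (u θ) r) t
  have hc : Continuous (deriv (u θ)) :=
    (contDiff_uncurry_deriv_snd hu).continuous.comp (Continuous.prodMk_right θ)
  rw [zero_mul, one_mul, intervalIntegral.integral_deriv_eq_sub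
    (fun r _ => differentiable_uncurry_right hu θ r) (hc.intervalIntegrable _ _),
    Complex.real_smul] at h
  exact h

theorem continuous_hadamardQuotient {u : ℝ → ℝ → ℂ}
    (hu : ContDiff ℝ (⊤ : ℕ∞) (Function.uncurry u)) :
    Continuous (Function.uncurry (hadamardQuotient u)) := by
  refine intervalIntegral.continuous_parametric_intervalIntegral_of_continuous'
    (f := fun (p : ℝ × ℝ) s => deriv (u p.1) (s * p.2)) ?_ 0 1
  exact (contDiff_uncurry_deriv_snd hu).continuous.comp
    (g := Function.uncurry fun θ t => deriv (u θ) t)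
    (f := fun q : (ℝ × ℝ) × ℝ => (q.1.1, q.2 * q.1.2)) (by fun_prop)

theorem exists_hasDerivAt_hadamardQuotient {u : ℝ → ℝ → ℂ}
    (hu : ContDiff ℝ (⊤ : ℕ∞) (Function.uncurry u)) :
    ∃ q : ℝ → ℝ → ℂ, Continuous (Function.uncurry q) ∧
      ∀ θ t, HasDerivAt (fun φ => hadamardQuotient u φ t) (q θ t) θ := by
  have h1 := contDiff_uncurry_deriv_snd hu
  have h2 := contDiff_uncurry_deriv_fst h1
  refine ⟨fun θ t => ∫ s in (0 : ℝ)..1, deriv (fun φ => deriv (u φ) (s * t)) θ, ?_,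
    fun θ t => ?_⟩
  · refine intervalIntegral.continuous_parametric_intervalIntegral_of_continuous'
      (f := fun (p : ℝ × ℝ) s => deriv (fun φ => deriv (u φ) (s * p.2)) p.1) ?_ 0 1
    exact h2.continuous.comp
      (g := Function.uncurry fun θ t => deriv (fun φ => deriv (u φ) t) θ)
      (f := fun q : (ℝ × ℝ) × ℝ => (q.1.1, q.2 * q.1.2)) (by fun_prop)
  · refine hasDerivAt_intervalIntegral_param (w := fun φ s => deriv (u φ) (s * t))
      (w' := fun φ s => deriv (fun φ => deriv (u φ) (s * t)) φ) ?_ ?_ ?_ θ 0 1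
    · exact h1.continuous.comp (g := Function.uncurry fun θ t => deriv (u θ) t)
        (f := fun q : ℝ × ℝ => (q.1, q.2 * t)) (by fun_prop)
    · exact h2.continuous.comp
        (g := Function.uncurry fun θ t => deriv (fun φ => deriv (u φ) t) θ)
        (f := fun q : ℝ × ℝ => (q.1, q.2 * t)) (by fun_prop)
    · exact fun φ s => (differentiable_uncurry_left h1 (s * t) φ).hasDerivAt

/-- The principal value of `∫ u t / t` is the integral of the quotient `(u t - c) / t`, the constant
`c = u 0` cancelling by oddness. -/
theorem tendsto_principalValue {u : ℝ → ℂ} {k : ℝ → ℂ} {R : ℝ} {c : ℂ} (hR : 0 < R)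
    (hk : Continuous k) (huk : ∀ t : ℝ, (t : ℂ) * k t = u t - c)
    (hu : ∀ t : ℝ, R ≤ |t| → u t = 0) :
    Filter.Tendsto (fun ε : ℝ => ∫ t in {t : ℝ | ε < |t|}, u t / (t : ℂ))
      (nhdsWithin 0 (Set.Ioi 0)) (nhds (∫ t in (-R)..R, k t)) := by
  have hprim (a : ℝ) : Continuous fun b => ∫ t in a..b, k t :=
    intervalIntegral.continuous_primitive (fun _ _ => hk.intervalIntegrable _ _) a
  have hlim : Filter.Tendsto (fun ε : ℝ => (∫ t in (-R)..(-ε), k t) + ∫ t in ε..R, k t)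
      (nhdsWithin 0 (Set.Ioi 0)) (nhds (∫ t in (-R)..R, k t)) := by
    have hc : Continuous fun ε : ℝ => (∫ t in (-R)..(-ε), k t) + ∫ t in ε..R, k t := by
      simp_rw [fun ε => intervalIntegral.integral_symm (f := k) (μ := volume) R ε]
      exact ((hprim _).comp continuous_neg).add (hprim _).neg
    have := hc.tendsto 0
    rw [neg_zero, intervalIntegral.integral_add_adjacent_intervals
      (hk.intervalIntegrable _ _) (hk.intervalIntegrable _ _)] at this
    exact this.mono_left nhdsWithin_le_nhds
  refine hlim.congr' ?_
  filter_upwards [Ioo_mem_nhdsGT hR] with ε ⟨hε, hεR⟩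
  have hne (t : ℝ) (ht : t ≠ 0) : u t / (t : ℂ) = k t + c * ((t⁻¹ : ℝ) : ℂ) := by
    have : (t : ℂ) ≠ 0 := by exact_mod_cast ht
    have h := huk t
    push_cast
    field_simp
    linear_combination -h
  have hsub : Set.Ioo (-R) (-ε) ∪ Set.Ioo ε R ⊆ {t : ℝ | ε < |t|} := by
    rintro t (⟨-, h⟩ | ⟨h, -⟩)
    · exact lt_abs.2 (Or.inr (lt_neg.1 h))
    · exact lt_abs.2 (Or.inl h)
  have hinv (a b : ℝ) (h : (0 : ℝ) ∉ Set.uIcc a b) :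
      IntervalIntegrable (fun t : ℝ => c * ((t⁻¹ : ℝ) : ℂ)) volume a b :=
    ContinuousOn.intervalIntegrable <| continuousOn_const.mul <|
      continuous_ofReal.comp_continuousOn <|
        continuousOn_inv₀.mono fun t ht h0 => h (Set.mem_singleton_iff.1 h0 ▸ ht)
  have hn : (0 : ℝ) ∉ Set.uIcc (-R) (-ε) := by
    rw [Set.uIcc_of_le (by linarith)]; exact fun h => by linarith [h.2]
  have hp : (0 : ℝ) ∉ Set.uIcc ε R := by
    rw [Set.uIcc_of_le (by linarith)]; exact fun h => by linarith [h.1]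
  have hcong (a b : ℝ) (h : (0 : ℝ) ∉ Set.uIcc a b) :
      Set.EqOn (fun t : ℝ => k t + c * ((t⁻¹ : ℝ) : ℂ)) (fun t => u t / (t : ℂ)) (Set.uIcc a b) :=
    fun t ht => (hne t fun h0 => h (h0 ▸ ht)).symm
  have hint (a b : ℝ) (h : (0 : ℝ) ∉ Set.uIcc a b) :
      IntervalIntegrable (fun t : ℝ => u t / (t : ℂ)) volume a b :=
    ((hk.intervalIntegrable a b).add (hinv a b h)).congr
      ((hcong a b h).mono Set.uIoc_subset_uIcc)
  have hval (a b : ℝ) (h : (0 : ℝ) ∉ Set.uIcc a b) :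
      ∫ t in a..b, u t / (t : ℂ) = (∫ t in a..b, k t) + ∫ t in a..b, c * ((t⁻¹ : ℝ) : ℂ) := by
    rw [← intervalIntegral.integral_add (hk.intervalIntegrable a b) (hinv a b h)]
    exact (intervalIntegral.integral_congr (hcong a b h)).symm
  have hodd : (∫ t in (-R)..(-ε), c * ((t⁻¹ : ℝ) : ℂ)) = -∫ t in ε..R, c * ((t⁻¹ : ℝ) : ℂ) := by
    rw [← intervalIntegral.integral_comp_neg, ← intervalIntegral.integral_neg]
    simp [inv_neg]
  rw [setIntegral_eq_of_subset_of_forall_sdiff_eq_zero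
    (measurableSet_lt measurable_const continuous_abs.measurable) hsub ?_, setIntegral_union ?_
    measurableSet_Ioo, ← integral_Ioc_eq_integral_Ioo, ← integral_Ioc_eq_integral_Ioo,
    ← intervalIntegral.integral_of_le (by linarith), ← intervalIntegral.integral_of_le hεR.le,
    hval _ _ hn, hval _ _ hp, hodd]
  · ring
  · exact (intervalIntegrable_iff_integrableOn_Ioo_of_le (by linarith)).1 (hint _ _ hn)
  · exact (intervalIntegrable_iff_integrableOn_Ioo_of_le hεR.le).1 (hint _ _ hp)
  · exact Set.disjoint_left.2 fun t h1 h2 => by linarith [h1.2, h2.1]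
  · rintro t ⟨ht, hnt⟩
    rw [hu t ?_, zero_div]
    by_contra! hlt
    obtain ⟨h1, h2⟩ := abs_lt.1 hlt
    have hεt : ε < |t| := ht
    rcases lt_abs.1 hεt with h | h
    · exact hnt (Or.inr ⟨h, h2⟩)
    · exact hnt (Or.inl ⟨h1, by linarith⟩)

/-- Integration by parts in polar coordinates for the field `cos θ ∂_t - (sin θ / t) ∂_θ`. -/
theorem integral_mul_directional_derivative {a F g : ℝ → ℝ → ℂ} {R : ℝ} {c : ℂ}
    (ha : ContDiff ℝ (⊤ : ℕ∞) (Function.uncurry a))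
    (hF : ContDiff ℝ (⊤ : ℕ∞) (Function.uncurry F))
    (hFc : ∀ θ, F θ 0 = c) (hR : ∀ θ, F θ R = 0) (hR' : ∀ θ, F θ (-R) = 0)
    (hg : ∀ θ t : ℝ, (t : ℂ) * g θ t = (Real.cos θ : ℂ) * (t * deriv (F θ) t) -
      (Real.sin θ : ℂ) * deriv (fun φ => F φ t) θ) :
    ∫ θ in (0 : ℝ)..(2 * Real.pi), ∫ t in (-R)..R, a θ t * g θ t =
      (∫ θ in (0 : ℝ)..(2 * Real.pi), deriv (fun φ => (Real.sin φ : ℂ) * a φ 0) θ *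
        ∫ t in (-R)..R, hadamardQuotient F θ t) +
      ∫ θ in (0 : ℝ)..(2 * Real.pi), ∫ t in (-R)..R,
        (deriv (fun φ => (Real.sin φ : ℂ) * hadamardQuotient a φ t) θ -
          deriv (fun r => ((r * Real.cos θ : ℝ) : ℂ) * hadamardQuotient a θ r) t) * F θ t := by
  obtain ⟨q, hqc, hq⟩ := exists_hasDerivAt_hadamardQuotient hF
  obtain ⟨p, hpc, hp⟩ := exists_hasDerivAt_hadamardQuotient ha
  set K := hadamardQuotient F
  set B := hadamardQuotient a
  have hK : Continuous (Function.uncurry K) := continuous_hadamardQuotient hF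
  have hB : Continuous (Function.uncurry B) := continuous_hadamardQuotient ha
  have hat := (contDiff_uncurry_deriv_snd ha).continuous
  have hFt := (contDiff_uncurry_deriv_snd hF).continuous
  have haθ := (contDiff_uncurry_deriv_fst ha).continuous
  have hac := ha.continuous
  have hFcont := hF.continuous
  have hsin (θ : ℝ) : HasDerivAt (fun φ : ℝ => (Real.sin φ : ℂ)) (Real.cos θ : ℂ) θ :=
    (Real.hasDerivAt_sin θ).ofReal_comp
  have haB (θ t : ℝ) : a θ t = a θ 0 + t * B θ t := by rw [mul_hadamardQuotient ha]; ring
  have hFK (θ t : ℝ) : (t : ℂ) * K θ t = F θ t - c := by rw [mul_hadamardQuotient hF, hFc]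
  have hFθ (θ t : ℝ) : deriv (fun φ => F φ t) θ = t * q θ t := by
    have h := ((hq θ t).const_mul (t : ℂ)).add_const c
    have he : (fun φ => F φ t) = fun φ => (t : ℂ) * K φ t + c := by
      funext φ; rw [hFK]; ring
    rw [he]; exact h.deriv
  set S₀ : ℝ → ℂ := fun θ => Real.cos θ * a θ 0 + Real.sin θ * deriv (fun φ => a φ 0) θ
  set S₁ : ℝ → ℝ → ℂ := fun θ t => Real.cos θ * B θ t + Real.sin θ * p θ t
  have hS₀ (θ : ℝ) : HasDerivAt (fun φ : ℝ => (Real.sin φ : ℂ) * a φ 0) (S₀ θ) θ :=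
    (hsin θ).mul (differentiable_uncurry_left ha 0 θ).hasDerivAt
  have hS₁ (θ t : ℝ) : HasDerivAt (fun φ : ℝ => (Real.sin φ : ℂ) * B φ t) (S₁ θ t) θ :=
    (hsin θ).mul (hp θ t)
  have hT (θ t : ℝ) : deriv (fun r => ((r * Real.cos θ : ℝ) : ℂ) * B θ r) t =
      Real.cos θ * deriv (a θ) t := by
    have he : (fun r => ((r * Real.cos θ : ℝ) : ℂ) * B θ r) =
        fun r => (Real.cos θ : ℂ) * (a θ r - a θ 0) := by
      funext r; rw [haB θ r]; push_cast; ring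
    rw [he]
    exact (((differentiable_uncurry_right ha θ t).hasDerivAt.sub_const _).const_mul _).deriv
  set E₁ : ℝ → ℝ → ℂ := fun θ t =>
    (S₀ θ + t * S₁ θ t) * K θ t + Real.sin θ * a θ t * q θ t + c * S₁ θ t
  set E₂ : ℝ → ℝ → ℂ := fun θ t => Real.cos θ * (deriv (a θ) t * F θ t + a θ t * deriv (F θ) t)
  set G : ℝ → ℝ → ℂ := fun θ t =>
    a θ t * (Real.cos θ * deriv (F θ) t - Real.sin θ * q θ t)
  have hcos : Continuous fun z : ℝ × ℝ => (Real.cos z.1 : ℂ) := by fun_prop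
  have hsinc : Continuous fun z : ℝ × ℝ => (Real.sin z.1 : ℂ) := by fun_prop
  have htc : Continuous fun z : ℝ × ℝ => (z.2 : ℂ) := by fun_prop
  have hfst : Continuous fun z : ℝ × ℝ => (z.1, (0 : ℝ)) := by fun_prop
  have hS₀c : Continuous fun z : ℝ × ℝ => S₀ z.1 :=
    (hcos.mul (hac.comp hfst)).add (hsinc.mul (haθ.comp hfst))
  have hS₁c : Continuous (Function.uncurry S₁) := (hcos.mul hB).add (hsinc.mul hpc)
  have hE₁c : Continuous (Function.uncurry E₁) :=
    (((hS₀c.add (htc.mul hS₁c)).mul hK).add ((hsinc.mul hac).mul hqc)).add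
      (continuous_const.mul hS₁c)
  have hE₂c : Continuous (Function.uncurry E₂) :=
    hcos.mul ((hat.mul hFcont).add (hac.mul hFt))
  have hGc : Continuous (Function.uncurry G) :=
    hac.mul ((hcos.mul hFt).sub (hsinc.mul hqc))
  have hE₁ : ∫ θ in (0 : ℝ)..(2 * Real.pi), ∫ t in (-R)..R, E₁ θ t = 0 := by
    rw [intervalIntegral_intervalIntegral_swap
      ((hE₁c.continuousOn.integrableOn_compact (isCompact_uIcc.prod isCompact_uIcc)).mono_set
        (Set.prod_mono Set.uIoc_subset_uIcc Set.uIoc_subset_uIcc))]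
    refine intervalIntegral.integral_zero_ae (Filter.Eventually.of_forall fun t _ => ?_)
    have hd (θ : ℝ) : HasDerivAt (fun φ : ℝ => (Real.sin φ : ℂ) * a φ t * K φ t +
        c * ((Real.sin φ : ℂ) * B φ t)) (E₁ θ t) θ := by
      have h1 : HasDerivAt (fun φ : ℝ => (Real.sin φ : ℂ) * a φ t) (S₀ θ + t * S₁ θ t) θ := by
        have he : (fun φ : ℝ => (Real.sin φ : ℂ) * a φ t) =
            fun φ : ℝ => (Real.sin φ : ℂ) * a φ 0 + t * ((Real.sin φ : ℂ) * B φ t) := by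
          funext φ; rw [haB φ t]; ring
        rw [he]
        exact (hS₀ θ).add ((hS₁ θ t).const_mul _)
      exact (h1.mul (hq θ t)).add ((hS₁ θ t).const_mul c)
    rw [intervalIntegral.integral_eq_sub_of_hasDerivAt (fun θ _ => hd θ)
      ((hE₁c.comp (Continuous.prodMk_left t)).intervalIntegrable _ _)]
    simp
  have hE₂ : ∫ θ in (0 : ℝ)..(2 * Real.pi), ∫ t in (-R)..R, E₂ θ t = 0 := by
    refine intervalIntegral.integral_zero_ae (Filter.Eventually.of_forall fun θ _ => ?_)
    have hd (t : ℝ) : HasDerivAt (fun r : ℝ => (Real.cos θ : ℂ) * (a θ r * F θ r)) (E₂ θ t) t :=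
      ((differentiable_uncurry_right ha θ t).hasDerivAt.mul
        (differentiable_uncurry_right hF θ t).hasDerivAt).const_mul _
    rw [intervalIntegral.integral_eq_sub_of_hasDerivAt (fun t _ => hd t)
      ((hE₂c.comp (Continuous.prodMk_right θ)).intervalIntegrable _ _)]
    simp [hR, hR']
  have hL (θ : ℝ) : ∫ t in (-R)..R, a θ t * g θ t = ∫ t in (-R)..R, G θ t := by
    refine intervalIntegral.integral_congr_ae ?_
    filter_upwards [compl_mem_ae_iff.2 (measure_singleton (0 : ℝ))] with t ht _
    have ht' : (t : ℂ) ≠ 0 := by exact_mod_cast ht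
    refine congrArg (a θ t * ·) (mul_left_cancel₀ ht' ?_)
    rw [hg, hFθ]; ring
  have hint {h : ℝ → ℝ → ℂ} (hh : Continuous (Function.uncurry h)) :
      IntervalIntegrable (fun θ => ∫ t in (-R)..R, h θ t) volume 0 (2 * Real.pi) :=
    (intervalIntegral.continuous_parametric_intervalIntegral_of_continuous'
      hh (-R) R).intervalIntegrable _ _
  have hint' {h : ℝ → ℝ → ℂ} (hh : Continuous (Function.uncurry h)) (θ : ℝ) :
      IntervalIntegrable (h θ) volume (-R) R :=
    (hh.comp (Continuous.prodMk_right θ)).intervalIntegrable _ _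
  have hPc : Continuous (Function.uncurry fun θ t => S₀ θ * K θ t) := hS₀c.mul hK
  have hQc : Continuous (Function.uncurry fun θ t =>
      (S₁ θ t - Real.cos θ * deriv (a θ) t) * F θ t) := (hS₁c.sub (hcos.mul hat)).mul hFcont
  simp_rw [hL, (hS₀ _).deriv, (hS₁ _ _).deriv, hT, ← intervalIntegral.integral_const_mul]
  rw [← intervalIntegral.integral_add (hint hPc) (hint hQc), ← sub_eq_zero, ← hE₂]
  rw [sub_eq_iff_eq_add, ← add_zero (∫ θ in _.._, ∫ t in _.._, G θ t), ← hE₁,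
    ← intervalIntegral.integral_add (hint hGc) (hint hE₁c),
    ← intervalIntegral.integral_add (hint hE₂c) ((hint hPc).add (hint hQc))]
  refine intervalIntegral.integral_congr fun θ _ => ?_
  rw [← intervalIntegral.integral_add (hint' hGc θ) (hint' hE₁c θ),
    ← intervalIntegral.integral_add (hint' hPc θ) (hint' hQc θ),
    ← intervalIntegral.integral_add (hint' hE₂c θ) ((hint' hPc θ).add (hint' hQc θ))]
  refine intervalIntegral.integral_congr fun t _ => ?_
  simp only [G, E₁, E₂]
  linear_combination S₁ θ t * hFK θ t

/-- Lemma 5.3: a spatial derivative of `f` can be moved onto the kernel of `T_A`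
at the cost of a directional Hilbert-transform term:
`T_A(∂_{x₁}f)(x) = π ∫_0^{2π} Ã₀(x,θ)·Hf(x,θ) dθ + T_{Ã₁}f(x)` on `𝔻`, where
`Hf(x,θ) = lim_{ε→0⁺} (1/π)∫_{|t|>ε} f(x + t·e^{iθ})/t dt` exists. -/
theorem stmt9 (A : ℂ → ℝ → ℝ → ℂ)
    (hA : ContDiff ℝ (⊤ : ℕ∞) fun p : ℂ × ℝ × ℝ => A p.1 p.2.1 p.2.2)
    (hper : ∀ x θ t, A x (θ + 2 * Real.pi) t = A x θ t)
    (hbdd : ∀ n : ℕ, ∃ M : ℝ, ∀ p : ℂ × ℝ × ℝ,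
      ‖iteratedFDeriv ℝ n (fun q : ℂ × ℝ × ℝ => A q.1 q.2.1 q.2.2) p‖ ≤ M)
    (f : ℂ → ℂ) (hf : ContDiff ℝ (⊤ : ℕ∞) f) (hfc : HasCompactSupport f)
    (hsupp : tsupport f ⊆ Metric.ball (0 : ℂ) 1) :
    ∃ Hf : ℂ → ℝ → ℂ,
      (∀ x ∈ Metric.ball (0 : ℂ) 1, ∀ θ : ℝ,
        Filter.Tendsto
          (fun ε : ℝ =>
            ((1 / Real.pi : ℝ) : ℂ) *
              ∫ t in {t : ℝ | ε < |t|},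
                f (x + (t : ℂ) * Complex.exp ((θ : ℂ) * Complex.I)) / (t : ℂ))
          (nhdsWithin 0 (Set.Ioi 0)) (nhds (Hf x θ))) ∧
      ∀ x ∈ Metric.ball (0 : ℂ) 1,
        TA A (fun y => fderiv ℝ f y 1) x =
          ((Real.pi : ℝ) : ℂ) * (∫ θ in (0 : ℝ)..(2 * Real.pi), Atilde0 A x θ * Hf x θ) +
            TA (Atilde1 A) f x := by
  set e : ℝ → ℂ := fun θ => Complex.exp ((θ : ℂ) * Complex.I) with he
  set F : ℂ → ℝ → ℝ → ℂ := fun x θ t => f (x + (t : ℂ) * e θ) with hFdef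
  have hec : ContDiff ℝ (⊤ : ℕ∞) e :=
    (ofRealCLM.contDiff.mul contDiff_const).cexp
  have hF (x : ℂ) : ContDiff ℝ (⊤ : ℕ∞) (Function.uncurry (F x)) :=
    hf.comp (contDiff_const.add
      ((ofRealCLM.contDiff.comp contDiff_snd).mul (hec.comp contDiff_fst)))
  have hout {x : ℂ} (hx : x ∈ Metric.ball (0 : ℂ) 1) (θ t : ℝ) (ht : 2 ≤ |t|) :
      x + (t : ℂ) * e θ ∉ tsupport f := fun hmem => by
    have h1 := mem_ball_zero_iff.1 (hsupp hmem)
    have h2 := mem_ball_zero_iff.1 hx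
    have h3 : ‖(t : ℂ) * e θ‖ = |t| := by simp [he, norm_exp_ofReal_mul_I]
    have h4 := norm_sub_le (x + (t : ℂ) * e θ) x
    rw [add_sub_cancel_left, h3] at h4
    linarith
  have hF0 {x : ℂ} (hx : x ∈ Metric.ball (0 : ℂ) 1) (θ t : ℝ) (ht : 2 ≤ |t|) : F x θ t = 0 :=
    image_eq_zero_of_notMem_tsupport (f := f) (hout hx θ t ht)
  refine ⟨fun x θ => ((1 / Real.pi : ℝ) : ℂ) * ∫ t in (-2 : ℝ)..2, hadamardQuotient (F x) θ t,
    fun x hx θ => ?_, fun x hx => ?_⟩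
  · exact (tendsto_principalValue two_pos
      ((continuous_hadamardQuotient (hF x)).comp (Continuous.prodMk_right θ))
      (mul_hadamardQuotient (hF x) θ) (hF0 hx θ)).const_mul _
  have ha : ContDiff ℝ (⊤ : ℕ∞) (Function.uncurry (A x)) :=
    hA.comp (contDiff_const.prodMk contDiff_id)
  have hTA (B : ℝ → ℝ → ℂ) (h : ℂ → ℂ)
      (hh : ∀ θ t : ℝ, 2 ≤ |t| → h (x + (t : ℂ) * e θ) = 0) (θ : ℝ) :
      ∫ t : ℝ, B θ t * h (x + (t : ℂ) * e θ) =
        ∫ t in (-2 : ℝ)..2, B θ t * h (x + (t : ℂ) * e θ) := by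
    refine (intervalIntegral.integral_eq_integral_of_support_subset fun t ht => ?_).symm
    have h2 : |t| < 2 := by
      by_contra! h2
      exact ht (by simp [hh θ t h2])
    exact ⟨(abs_lt.1 h2).1, (abs_lt.1 h2).2.le⟩
  have hdf (y : ℂ) : HasFDerivAt f (fderiv ℝ f y) y := (hf.differentiable (by simp) y).hasFDerivAt
  have hg (θ t : ℝ) : (t : ℂ) * fderiv ℝ f (x + (t : ℂ) * e θ) 1 =
      (Real.cos θ : ℂ) * (t * deriv (F x θ) t) -
        (Real.sin θ : ℂ) * deriv (fun φ => F x φ t) θ := by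
    set L := fderiv ℝ f (x + (t : ℂ) * e θ) with hL
    have h1 : deriv (F x θ) t = L (e θ) := by
      have hd : HasDerivAt (fun r : ℝ => x + (r : ℂ) * e θ) (1 * e θ) t :=
        ((hasDerivAt_id t).ofReal_comp.mul_const _).const_add x
      rw [one_mul] at hd
      exact ((hdf _).comp_hasDerivAt t hd).deriv
    have h2 : deriv (fun φ => F x φ t) θ = L (t * (e θ * (1 * I))) := by
      have hd : HasDerivAt (fun φ : ℝ => x + (t : ℂ) * e φ) (t * (e θ * (1 * I))) θ :=
        ((((hasDerivAt_id θ).ofReal_comp.mul_const I).cexp).const_mul _).const_add x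
      exact ((hdf _).comp_hasDerivAt θ hd).deriv
    have h3 : e θ = Real.cos θ • (1 : ℂ) + Real.sin θ • I := by
      simp [he, exp_mul_I]
    have h4 : (t : ℂ) * (e θ * (1 * I)) = t • (Real.cos θ • I - Real.sin θ • (1 : ℂ)) := by
      rw [h3]
      simp only [real_smul]
      linear_combination (t * Real.sin θ : ℂ) * I_mul_I
    rw [h1, h2, h4, h3]
    simp only [map_add, map_sub, map_smul]
    simp only [real_smul]
    have h5 : (Real.sin θ : ℂ) ^ 2 + (Real.cos θ : ℂ) ^ 2 = 1 := by
      exact_mod_cast Real.sin_sq_add_cos_sq θ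
    linear_combination -(t * L 1) * h5
  have key := integral_mul_directional_derivative (a := A x) (F := F x) (R := 2) (c := f x)
    (g := fun θ t => fderiv ℝ f (x + (t : ℂ) * e θ) 1) ha (hF x) (by simp [hFdef])
    (fun θ => hF0 hx θ 2 (by simp)) (fun θ => hF0 hx θ (-2) (by simp)) hg
  have hfd (θ t : ℝ) (ht : 2 ≤ |t|) : fderiv ℝ f (x + (t : ℂ) * e θ) 1 = 0 := by
    rw [fderiv_of_notMem_tsupport (𝕜 := ℝ) (hout hx θ t ht)]; rfl
  unfold TA
  rw [funext (hTA (A x) (fun y => fderiv ℝ f y 1) hfd), funext (hTA (Atilde1 A x) f (hF0 hx))]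
  refine key.trans (congrArg₂ (· + ·) ?_ rfl)
  rw [← intervalIntegral.integral_const_mul]
  refine intervalIntegral.integral_congr fun θ _ => ?_
  simp only [Atilde0, Azero]
  push_cast
  field_simp
end
end

section
/- For integers n ≥ 0 and k ∈ ℤ define ψ⁺_{n,k}, ψ⁻_{n,k} : ℝ² → ℂ by ψ⁺_{n,k}(α, β) = ((−1)^n / (4π)) · e^{i(n−2k)(α+β)} · ( e^{i(n+1)α} + (−1)^n e^{−i(n+1)α} ) and ψ⁻_{n,k}(α, β) = e^{i(α+β+π)} · ψ⁺_{n,k}(α, β), and let P denote the differential operator P = −( (∂_α − ∂_β)² + ∂_β² ). Then P ψ⁺_{n,k} = ( (1+n)² + (n−2k)² ) · ψ⁺_{n,k} and P ψ⁻_{n,k} = ( (1+n)² + (n−2k+1)² ) · ψ⁻_{n,k}. -/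
noncomputable section

open Complex

/-- The fan-beam boundary function `ψ⁺_{n,k}` on `ℝ²` (coordinates `(α, β)`). -/
def psiPlus (n : ℕ) (k : ℤ) (p : ℝ × ℝ) : ℂ :=
  (-1 : ℂ) ^ n / (4 * (Real.pi : ℂ)) *
    Complex.exp (Complex.I * ((n : ℂ) - 2 * (k : ℂ)) * ((p.1 : ℂ) + (p.2 : ℂ))) *
    (Complex.exp (Complex.I * ((n : ℂ) + 1) * (p.1 : ℂ)) +
      (-1 : ℂ) ^ n * Complex.exp (-(Complex.I * ((n : ℂ) + 1) * (p.1 : ℂ))))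

/-- The fan-beam boundary function `ψ⁻_{n,k}`. -/
def psiMinus (n : ℕ) (k : ℤ) (p : ℝ × ℝ) : ℂ :=
  Complex.exp (Complex.I * ((p.1 : ℂ) + (p.2 : ℂ) + (Real.pi : ℂ))) * psiPlus n k p

/-- Partial derivative in the first coordinate `α`. -/
def dAlpha (g : ℝ × ℝ → ℂ) : ℝ × ℝ → ℂ := fun p => deriv (fun s => g (s, p.2)) p.1

/-- Partial derivative in the second coordinate `β`. -/
def dBeta (g : ℝ × ℝ → ℂ) : ℝ × ℝ → ℂ := fun p => deriv (fun s => g (p.1, s)) p.2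

/-- The operator `∂_α − ∂_β`. -/
def Dab (g : ℝ × ℝ → ℂ) : ℝ × ℝ → ℂ := fun p => dAlpha g p - dBeta g p

/-- The differential operator `P = −((∂_α − ∂_β)² + ∂_β²)`. -/
def Pop (g : ℝ × ℝ → ℂ) : ℝ × ℝ → ℂ := fun p => -(Dab (Dab g) p + dBeta (dBeta g) p)

/-- A superposition of two plane waves with wave vectors `(m + N, m)` and `(m - N, m)`. -/
def planeWavePair (m N A B : ℂ) (p : ℝ × ℝ) : ℂ :=
  A * Complex.exp (Complex.I * ((m + N) * p.1 + m * p.2)) +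
    B * Complex.exp (Complex.I * ((m - N) * p.1 + m * p.2))

theorem hasDerivAt_exp_I_affine (a b : ℂ) (s : ℝ) :
    HasDerivAt (fun t : ℝ => Complex.exp (Complex.I * (a * t + b)))
      (Complex.I * a * Complex.exp (Complex.I * (a * s + b))) s := by
  have h : HasDerivAt (fun t : ℝ => Complex.I * (a * (t : ℂ) + b)) (Complex.I * (a * 1)) s :=
    (((hasDerivAt_id s).ofReal_comp.const_mul a).add_const b).const_mul Complex.I
  convert h.cexp using 1
  ring

theorem dAlpha_planeWavePair (m N A B : ℂ) :
    dAlpha (planeWavePair m N A B) =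
      planeWavePair m N (Complex.I * (m + N) * A) (Complex.I * (m - N) * B) := by
  funext p
  have h := ((hasDerivAt_exp_I_affine (m + N) (m * p.2) p.1).const_mul A).add
    ((hasDerivAt_exp_I_affine (m - N) (m * p.2) p.1).const_mul B)
  refine h.deriv.trans ?_
  simp only [planeWavePair]
  ring

theorem dBeta_planeWavePair (m N A B : ℂ) :
    dBeta (planeWavePair m N A B) =
      planeWavePair m N (Complex.I * m * A) (Complex.I * m * B) := by
  funext p
  have h := ((hasDerivAt_exp_I_affine m ((m + N) * p.1) p.2).const_mul A).add
    ((hasDerivAt_exp_I_affine m ((m - N) * p.1) p.2).const_mul B)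
  simp only [add_comm (m * _)] at h
  refine h.deriv.trans ?_
  simp only [planeWavePair]
  ring

theorem Dab_planeWavePair (m N A B : ℂ) :
    Dab (planeWavePair m N A B) =
      planeWavePair m N (Complex.I * N * A) (-(Complex.I * N * B)) := by
  funext p
  simp only [Dab, dAlpha_planeWavePair, dBeta_planeWavePair, planeWavePair]
  ring

theorem Pop_planeWavePair (m N A B : ℂ) (p : ℝ × ℝ) :
    Pop (planeWavePair m N A B) p = (N ^ 2 + m ^ 2) * planeWavePair m N A B p := by
  simp only [Pop, Dab_planeWavePair, dBeta_planeWavePair, planeWavePair]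
  ring_nf
  simp only [Complex.I_sq]
  ring

theorem psiPlus_eq_planeWavePair (n : ℕ) (k : ℤ) :
    psiPlus n k = planeWavePair (n - 2 * k) (1 + n)
      ((-1) ^ n / (4 * Real.pi)) ((-1) ^ n / (4 * Real.pi) * (-1) ^ n) := by
  funext p
  have e (a : ℂ) : Complex.exp (Complex.I * ((n : ℂ) - 2 * k) * ((p.1 : ℂ) + p.2)) *
      Complex.exp (Complex.I * a * p.1) =
      Complex.exp (Complex.I * ((n - 2 * k + a) * p.1 + (n - 2 * k) * p.2)) := by
    rw [← Complex.exp_add]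
    ring_nf
  simp only [psiPlus, planeWavePair]
  rw [sub_eq_add_neg _ (1 + (n : ℂ)), ← e, ← e]
  ring_nf

theorem psiMinus_eq_planeWavePair (n : ℕ) (k : ℤ) :
    psiMinus n k = planeWavePair (n - 2 * k + 1) (1 + n)
      (-((-1) ^ n / (4 * Real.pi))) (-((-1) ^ n / (4 * Real.pi) * (-1) ^ n)) := by
  funext p
  have h : Complex.exp (Complex.I * ((p.1 : ℂ) + p.2 + Real.pi)) =
      -Complex.exp (Complex.I * (p.1 + p.2)) := by
    rw [mul_add, Complex.exp_add, mul_comm Complex.I (Real.pi : ℂ), Complex.exp_pi_mul_I]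
    ring
  have e (a : ℂ) : Complex.exp (Complex.I * ((p.1 : ℂ) + p.2)) *
      Complex.exp (Complex.I * (a * p.1 + (n - 2 * k) * p.2)) =
      Complex.exp (Complex.I * ((a + 1) * p.1 + (n - 2 * k + 1) * p.2)) := by
    rw [← Complex.exp_add]
    ring_nf
  rw [psiMinus, h, psiPlus_eq_planeWavePair]
  simp only [planeWavePair]
  rw [add_right_comm _ (1 : ℂ) (1 + (n : ℂ)), add_sub_right_comm _ (1 : ℂ) (1 + (n : ℂ)),
    ← e, ← e]
  ring

/-- The functions `ψ±_{n,k}` are eigenfunctions of `P` with eigenvalues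
`(1+n)² + (n−2k)²` and `(1+n)² + (n−2k+1)²` respectively. -/
theorem stmt12 (n : ℕ) (k : ℤ) :
    (∀ p : ℝ × ℝ,
      Pop (psiPlus n k) p = (((1 : ℂ) + n) ^ 2 + ((n : ℂ) - 2 * k) ^ 2) * psiPlus n k p) ∧
    (∀ p : ℝ × ℝ,
      Pop (psiMinus n k) p =
        (((1 : ℂ) + n) ^ 2 + ((n : ℂ) - 2 * k + 1) ^ 2) * psiMinus n k p) := by
  rw [psiPlus_eq_planeWavePair, psiMinus_eq_planeWavePair]
  exact ⟨Pop_planeWavePair _ _ _ _, Pop_planeWavePair _ _ _ _⟩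
end
end

section
/- For all integers n ≥ 0 and 0 ≤ k ≤ n and all z ∈ ℂ, the Zernike polynomials satisfy z · Z_{n,k}(z) = (1 − k/(n+1)) · Z_{n+1,k}(z) − (k/(n+1)) · Z_{n−1,k−1}(z), with the convention that Z_{n−1,k−1} = 0 when k = 0. -/
noncomputable section

open Complex

/-- The Zernike polynomial `Z_{n,k}` (for `0 ≤ k ≤ n`), given by its explicit expansion
`Z_{n,k}(z) = Σ_{i = max(0, 2k−n)}^{k} (−1)^i (k choose i) ((n−k+i)!/((n−2k+i)!·k!))
  z^{n−2k+i} conj(z)^i`. -/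
def ZP (n k : ℕ) (z : ℂ) : ℂ :=
  ∑ i ∈ Finset.Icc (2 * k - n) k,
    (-1 : ℂ) ^ i * (k.choose i : ℂ) *
      ((((n + i - k).factorial / ((n + i - 2 * k).factorial * k.factorial) : ℕ)) : ℂ) *
      z ^ (n + i - 2 * k) * (starRingEnd ℂ z) ^ i

/-- The Zernike polynomial with integer indices and the convention that it vanishes
outside the range `0 ≤ k ≤ n`. -/
def ZPZ (n k : ℤ) (z : ℂ) : ℂ :=
  if 0 ≤ n ∧ 0 ≤ k ∧ k ≤ n then ZP n.toNat k.toNat z else 0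

/-- The expansion of a Zernike polynomial with binomial coefficients, summed over all `i ≤ k`. -/
lemma ZP_add_eq_sum_range (d k : ℕ) (z : ℂ) :
    ZP (k + d) k z = ∑ i ∈ Finset.range (k + 1),
      (-1 : ℂ) ^ i * (k.choose i : ℂ) * ((d + i).choose k : ℂ) * z ^ (d + i - k) *
        (starRingEnd ℂ z) ^ i := by
  unfold ZP
  have hsub : Finset.Icc (2 * k - (k + d)) k ⊆ Finset.range (k + 1) := fun i hi => by
    simp only [Finset.mem_Icc, Finset.mem_range] at *
    omega
  rw [← Finset.sum_subset hsub]
  · refine Finset.sum_congr rfl fun i hi => ?_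
    rw [Finset.mem_Icc] at hi
    have h₁ : k + d + i - k = d + i := by omega
    have h₂ : k + d + i - 2 * k = d + i - k := by omega
    rw [h₁, h₂, Nat.choose_eq_factorial_div_factorial (show k ≤ d + i by omega),
      mul_comm k.factorial]
  · intro i hi hi'
    simp only [Finset.mem_Icc, Finset.mem_range] at hi hi'
    rw [Nat.choose_eq_zero_of_lt (show d + i < k by omega)]
    simp

lemma ZPZ_natCast {n k : ℕ} (hk : k ≤ n) (z : ℂ) : ZPZ n k z = ZP n k z := by
  simp [ZPZ, hk]

/-- The recurrence between the coefficients of `Z_{n,k}`, `Z_{n+1,k}` and `Z_{n-1,k-1}`, where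
`k = j + 1` and `n = k + d`. -/
lemma zernike_coeff_recurrence (d j i : ℕ) :
    ((j : ℂ) + 1 + d + 1) * ((j + 1).choose i * (d + i).choose (j + 1)) =
      (d + 1) * ((j + 1).choose i * (d + 1 + i).choose (j + 1)) -
        (j + 1) * (j.choose i * (d + i).choose j) := by
  have h₁ : ((d + 1 + i).choose (j + 1) : ℂ) = (d + i).choose j + (d + i).choose (j + 1) := by
    rw [add_right_comm, Nat.choose_succ_succ]
    push_cast
    rfl
  have h₂ : ((j : ℂ) + 1) * j.choose i = (j + 1).choose i * ((j : ℂ) + 1 - i) := by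
    rcases le_or_gt i (j + 1) with h | h
    · have := Nat.choose_mul_succ_eq j i
      apply_fun ((↑) : ℕ → ℂ) at this
      push_cast [Nat.cast_sub h] at this
      linear_combination this
    · simp [Nat.choose_eq_zero_of_lt h, Nat.choose_eq_zero_of_lt (show j < i by omega)]
  have h₃ : ((d + i).choose (j + 1) : ℂ) * (j + 1) = (d + i).choose j * ((d : ℂ) + i - j) := by
    rcases le_or_gt j (d + i) with h | h
    · have := Nat.choose_succ_right_eq (d + i) j
      apply_fun ((↑) : ℕ → ℂ) at this
      push_cast [Nat.cast_sub h] at this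
      exact this
    · simp [Nat.choose_eq_zero_of_lt h, Nat.choose_eq_zero_of_lt (show d + i < j + 1 by omega)]
  rw [h₁]
  linear_combination ((j + 1).choose i : ℂ) * h₃ + ((d + i).choose j : ℂ) * h₂

lemma mul_ZP_succ (d j : ℕ) (z : ℂ) :
    ((j : ℂ) + 1 + d + 1) * (z * ZP (j + 1 + d) (j + 1) z) =
      (d + 1) * ZP (j + 1 + (d + 1)) (j + 1) z - (j + 1) * ZP (j + d) j z := by
  have h : ZP (j + d) j z = ∑ i ∈ Finset.range (j + 1 + 1),
      (-1 : ℂ) ^ i * (j.choose i : ℂ) * ((d + i).choose j : ℂ) * z ^ (d + i - j) *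
        (starRingEnd ℂ z) ^ i := by
    rw [Finset.sum_range_succ, ZP_add_eq_sum_range]
    simp
  rw [h, ZP_add_eq_sum_range, ZP_add_eq_sum_range]
  simp only [Finset.mul_sum]
  rw [← Finset.sum_sub_distrib]
  refine Finset.sum_congr rfl fun i _ => ?_
  have hpow : ((d + i).choose (j + 1) : ℂ) * (z * z ^ (d + i - (j + 1))) =
      (d + i).choose (j + 1) * z ^ (d + i - j) := by
    rcases le_or_gt (j + 1) (d + i) with h | h
    · rw [← pow_succ', show d + i - (j + 1) + 1 = d + i - j by omega]
    · simp [Nat.choose_eq_zero_of_lt h]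
  rw [show d + 1 + i - (j + 1) = d + i - j by omega]
  linear_combination
    ((j : ℂ) + 1 + d + 1) * (-1) ^ i * (j + 1).choose i * (starRingEnd ℂ z) ^ i * hpow +
      (-1) ^ i * z ^ (d + i - j) * (starRingEnd ℂ z) ^ i * zernike_coeff_recurrence d j i

/-- The recurrence `z·Z_{n,k} = (1 − k/(n+1))·Z_{n+1,k} − (k/(n+1))·Z_{n−1,k−1}`,
with the convention `Z_{n−1,k−1} = 0` when `k = 0`. -/
theorem stmt13 (n k : ℕ) (hk : k ≤ n) (z : ℂ) :
    z * ZPZ (n : ℤ) (k : ℤ) z =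
      (1 - (k : ℂ) / ((n : ℂ) + 1)) * ZPZ ((n : ℤ) + 1) (k : ℤ) z -
        ((k : ℂ) / ((n : ℂ) + 1)) * ZPZ ((n : ℤ) - 1) ((k : ℤ) - 1) z := by
  obtain ⟨d, rfl⟩ := Nat.exists_eq_add_of_le hk
  have hsucc : ((k + d : ℕ) : ℤ) + 1 = ((k + (d + 1) : ℕ) : ℤ) := by push_cast; ring
  rw [hsucc, ZPZ_natCast hk, ZPZ_natCast (Nat.le_add_right _ _)]
  cases k with
  | zero =>
    simp only [ZP_add_eq_sum_range]
    simp [pow_succ']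
  | succ j =>
    have hn : ((j + 1 + d : ℕ) : ℤ) - 1 = ((j + d : ℕ) : ℤ) := by push_cast; ring
    have hj : ((j + 1 : ℕ) : ℤ) - 1 = (j : ℤ) := by push_cast; ring
    rw [hn, hj, ZPZ_natCast (Nat.le_add_right _ _)]
    have hne : (j : ℂ) + 1 + d + 1 ≠ 0 := by exact_mod_cast Nat.succ_ne_zero (j + 1 + d)
    push_cast
    field_simp
    linear_combination mul_ZP_succ d j z
end
end

section
/- For all integers n ≥ 0 and 0 ≤ k ≤ n and all z ∈ ℂ: z · ∂_z Z_{n,k}(z) − conj(z) · ∂_{z̄} Z_{n,k}(z) = (n − 2k) · Z_{n,k}(z). -/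
noncomputable section

open Complex

/-- Directional derivative of `f : ℂ → ℂ` in the direction `1` (the derivative `∂_x f`). -/
def pdx (f : ℂ → ℂ) (z : ℂ) : ℂ := fderiv ℝ f z 1

/-- Directional derivative of `f : ℂ → ℂ` in the direction `i` (the derivative `∂_y f`). -/
def pdy (f : ℂ → ℂ) (z : ℂ) : ℂ := fderiv ℝ f z Complex.I

/-- The Wirtinger derivative `∂_z f = (1/2)(∂_x f − i·∂_y f)`. -/
def wdz (f : ℂ → ℂ) (z : ℂ) : ℂ := (1 / 2 : ℂ) * (pdx f z - Complex.I * pdy f z)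

/-- The conjugate Wirtinger derivative `∂_z̄ f = (1/2)(∂_x f + i·∂_y f)`. -/
def wdzbar (f : ℂ → ℂ) (z : ℂ) : ℂ := (1 / 2 : ℂ) * (pdx f z + Complex.I * pdy f z)

theorem mul_wdz_sub_conj_mul_wdzbar (f : ℂ → ℂ) (z : ℂ) :
    z * wdz f z - starRingEnd ℂ z * wdzbar f z = -I * fderiv ℝ f z (I * z) := by
  have h : I * z = (-z.im) • (1 : ℂ) + z.re • I := by
    apply Complex.ext <;> simp
  rw [h, map_add, map_smul, map_smul]
  simp only [wdz, wdzbar, pdx, pdy, real_smul]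
  have h₁ : starRingEnd ℂ z = z.re - z.im * I := by apply Complex.ext <;> simp
  nth_rewrite 1 [← re_add_im z]
  rw [h₁]
  push_cast
  ring

theorem hasFDerivAt_pow_mul_conj_pow (a b : ℕ) (z : ℂ) :
    HasFDerivAt (𝕜 := ℝ) (fun w : ℂ => w ^ a * starRingEnd ℂ w ^ b)
      (z ^ a • (b • starRingEnd ℂ z ^ (b - 1)) • (conjCLE : ℂ →L[ℝ] ℂ) +
        starRingEnd ℂ z ^ b • (a • z ^ (a - 1)) • ContinuousLinearMap.id ℝ ℂ) z := by
  have h : HasFDerivAt (starRingEnd ℂ : ℂ → ℂ) (conjCLE : ℂ →L[ℝ] ℂ) z :=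
    (conjCLE : ℂ →L[ℝ] ℂ).hasFDerivAt
  exact ((hasFDerivAt_id z).pow a).mul (h.pow b)

theorem fderiv_pow_mul_conj_pow_I_mul (a b : ℕ) (z : ℂ) :
    fderiv ℝ (fun w : ℂ => w ^ a * starRingEnd ℂ w ^ b) z (I * z) =
      I * ((a : ℂ) - b) * (z ^ a * starRingEnd ℂ z ^ b) := by
  rw [(hasFDerivAt_pow_mul_conj_pow a b z).fderiv]
  rcases a with _ | a <;> rcases b with _ | b <;> simp [pow_succ] <;> ring

/-- The identity `z·∂_z Z_{n,k} − conj(z)·∂_z̄ Z_{n,k} = (n − 2k)·Z_{n,k}`. -/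
theorem stmt15 (n k : ℕ) (hk : k ≤ n) (z : ℂ) :
    z * wdz (ZP n k) z - starRingEnd ℂ z * wdzbar (ZP n k) z =
      ((n : ℂ) - 2 * (k : ℂ)) * ZP n k z := by
  have hZ : ZP n k = fun w => ∑ i ∈ Finset.Icc (2 * k - n) k,
      ((-1 : ℂ) ^ i * (k.choose i : ℂ) *
        ((((n + i - k).factorial / ((n + i - 2 * k).factorial * k.factorial) : ℕ)) : ℂ)) *
        (w ^ (n + i - 2 * k) * starRingEnd ℂ w ^ i) := by
    funext w
    simp only [ZP, mul_assoc]
  have hd (i : ℕ) : DifferentiableAt ℝ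
      (fun w : ℂ => w ^ (n + i - 2 * k) * starRingEnd ℂ w ^ i) z :=
    (hasFDerivAt_pow_mul_conj_pow _ _ z).differentiableAt
  rw [mul_wdz_sub_conj_mul_wdzbar, hZ, fderiv_fun_sum fun i _ => (hd i).const_mul _,
    _root_.sum_apply, Finset.mul_sum, Finset.mul_sum]
  refine Finset.sum_congr rfl fun i hi => ?_
  have hi' : 2 * k ≤ n + i := by have := (Finset.mem_Icc.mp hi).1; omega
  rw [fderiv_const_mul (hd i), _root_.smul_apply, smul_eq_mul,
    fderiv_pow_mul_conj_pow_I_mul, Nat.cast_sub hi']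
  push_cast
  generalize (-1 : ℂ) ^ i * _ * _ = c
  generalize z ^ _ * _ = m
  linear_combination (-c * m * (n - 2 * k)) * I_sq
end
end
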